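/- Let d ≥ 1 and α > 0. Let u : ℝᵈ → ℝ ∪ {+∞} be a convex, essentially continuous function such that x ↦ exp(−u(x) − (α/2)‖x‖²) is a probability density on ℝᵈ; denote by ρ̄ the corresponding probability measure and let μ := (∇u)_♯ ρ̄ be the pushforward of ρ̄ under the gradient of u (defined ρ̄-almost everywhere). Then ρ̄ has finite first moment and ρ̄ is the minimizer of F_μ over all probability measures on ℝᵈ with finite first moment. -/

import Mathlib

open MeasureTheory ENNReal
open scoped RealInnerProductSpace

noncomputable section

/-- Euclidean space `ℝᵈ`. -/
abbrev Ed (d : ℕ) := EuclideanSpace ℝ (Fin d)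

/-- The positive part of an extended real number, as an element of `ℝ≥0∞`. -/
noncomputable def EReal.posPart (a : EReal) : ℝ≥0∞ :=
  if a = ⊤ then ⊤ else ENNReal.ofReal a.toReal

/-- Signed integral (with values in `EReal`) of a real-valued function. -/
noncomputable def sInt {α : Type*} [MeasurableSpace α] (ν : Measure α) (g : α → ℝ) : EReal :=
  ((∫⁻ x, ENNReal.ofReal (g x) ∂ν : ℝ≥0∞) : EReal) -
    ((∫⁻ x, ENNReal.ofReal (-(g x)) ∂ν : ℝ≥0∞) : EReal)

/-- Signed integral (with values in `EReal`) of an `EReal`-valued function. -/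
noncomputable def eInt {α : Type*} [MeasurableSpace α] (ν : Measure α) (f : α → EReal) : EReal :=
  ((∫⁻ x, (f x).posPart ∂ν : ℝ≥0∞) : EReal) - ((∫⁻ x, (-(f x)).posPart ∂ν : ℝ≥0∞) : EReal)

/-- The set of couplings (transport plans) between two measures on `ℝᵈ`. -/
def couplings {d : ℕ} (ρ μ : Measure (Ed d)) : Set (Measure (Ed d × Ed d)) :=
  {γ | IsProbabilityMeasure γ ∧ γ.map Prod.fst = ρ ∧ γ.map Prod.snd = μ}

/-- The maximal correlation functional `T(ρ, μ)`. -/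
noncomputable def maxCorr {d : ℕ} (ρ μ : Measure (Ed d)) : EReal :=
  ⨆ γ ∈ couplings ρ μ, sInt γ (fun p => ⟪p.1, p.2⟫)

/-- The entropy `E(ρ)` of a measure with respect to Lebesgue measure. -/
noncomputable def Ent {d : ℕ} (ρ : Measure (Ed d)) : EReal := by
  classical
  exact if _h : ρ ≪ (volume : Measure (Ed d)) then
    sInt (volume : Measure (Ed d))
      (fun x => (ρ.rnDeriv volume x).toReal * Real.log (ρ.rnDeriv volume x).toReal)
  else ⊤

/-- The second moment of a measure, with values in `ℝ≥0∞`. -/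
noncomputable def M2e {d : ℕ} (ρ : Measure (Ed d)) : ℝ≥0∞ :=
  ∫⁻ x, ENNReal.ofReal (‖x‖ ^ 2) ∂ρ

/-- The regularized functional `F_μ(ρ) = E(ρ) + T(ρ, μ) + (α/2) M₂(ρ)`. -/
noncomputable def Ffun {d : ℕ} (α : ℝ) (μ ρ : Measure (Ed d)) : EReal :=
  Ent ρ + maxCorr ρ μ + ((α / 2 : ℝ) : EReal) * ((M2e ρ : ℝ≥0∞) : EReal)

/-- The `p`-th moment `M_p(ρ) = ∫ ‖x‖^p dρ`. -/
noncomputable def Mp {d : ℕ} (p : ℝ) (ρ : Measure (Ed d)) : ℝ :=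
  ∫ x, ‖x‖ ^ p ∂ρ

/-- The barycenter `b(ρ) = ∫ x dρ`. -/
noncomputable def bary {d : ℕ} (ρ : Measure (Ed d)) : Ed d :=
  ∫ x, x ∂ρ

/-- Probability measures on `ℝᵈ` with finite first moment. -/
def P1 (d : ℕ) : Set (Measure (Ed d)) :=
  {ρ | IsProbabilityMeasure ρ ∧ Integrable (fun x => ‖x‖) ρ}

/-- Probability measures on `ℝᵈ` with finite second moment. -/
def P2 (d : ℕ) : Set (Measure (Ed d)) :=
  {ρ | IsProbabilityMeasure ρ ∧ Integrable (fun x => ‖x‖ ^ 2) ρ}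

/-- `ρ` is a minimizer of `F_μ` over probability measures with finite first moment. -/
def IsMinOfF {d : ℕ} (α : ℝ) (μ ρ : Measure (Ed d)) : Prop :=
  ρ ∈ P1 d ∧ ∀ σ ∈ P1 d, Ffun α μ ρ ≤ Ffun α μ σ

/-- The 2-Wasserstein distance between two measures on `ℝᵈ`. -/
noncomputable def W2 {d : ℕ} (ρ μ : Measure (Ed d)) : ℝ :=
  Real.sqrt ((⨅ γ ∈ couplings ρ μ, ∫⁻ p, ENNReal.ofReal (‖p.1 - p.2‖ ^ 2) ∂γ).toReal)

/-- Convexity of an `EReal`-valued function on `ℝᵈ`. -/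
def EConvexOn {d : ℕ} (u : Ed d → EReal) : Prop :=
  ∀ x y : Ed d, ∀ s t : ℝ, 0 ≤ s → 0 ≤ t → s + t = 1 →
    u (s • x + t • y) ≤ (s : EReal) * u x + (t : EReal) * u y

/-- The Legendre transform `u*(y) = sup_x (⟨x, y⟩ - u(x))` of an `EReal`-valued function. -/
noncomputable def legendre {d : ℕ} (u : Ed d → EReal) : Ed d → EReal :=
  fun y => ⨆ x : Ed d, (((⟪x, y⟫ : ℝ) : EReal) - u x)

/-- The Gaussian-regularized density `exp(-u(x) - (α/2)‖x‖²)`, with value `0` where `u = ⊤`. -/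
noncomputable def gdens {d : ℕ} (α : ℝ) (u : Ed d → EReal) (x : Ed d) : ℝ≥0∞ :=
  if u x = ⊤ then 0 else ENNReal.ofReal (Real.exp (-(u x).toReal - (α / 2) * ‖x‖ ^ 2))

/-- A convex `EReal`-valued function is essentially continuous if it is continuous at
`H^{d-1}`-almost every point of the boundary of its finiteness domain. -/
def EssentiallyContinuous {d : ℕ} (u : Ed d → EReal) : Prop :=
  μH[(d : ℝ) - 1] {x ∈ frontier {y : Ed d | u y < ⊤} | ¬ ContinuousAt u x} = 0

/-! ### Monotone transport on the line -/

/-- The generalized inverse, with values in `[-R, R]`, of a function on the line. -/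
def quantile (R : ℝ) (G : ℝ → ℝ) (v : ℝ) : ℝ :=
  sInf (insert R {y | y ∈ Set.Icc (-R) R ∧ v ≤ G y})

lemma quantile_bddBelow (R : ℝ) (hR : 0 ≤ R) (G : ℝ → ℝ) (v : ℝ) :
    -R ∈ lowerBounds (insert R {y | y ∈ Set.Icc (-R) R ∧ v ≤ G y}) := by
  rintro y (rfl | hy)
  · linarith
  · exact hy.1.1

lemma quantile_mem {R : ℝ} (hR : 0 ≤ R) (G : ℝ → ℝ) (v : ℝ) :
    quantile R G v ∈ Set.Icc (-R) R :=
  ⟨le_csInf ⟨R, Set.mem_insert _ _⟩ (quantile_bddBelow R hR G v),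
    csInf_le ⟨_, quantile_bddBelow R hR G v⟩ (Set.mem_insert _ _)⟩

lemma quantile_mono {R : ℝ} (hR : 0 ≤ R) (G : ℝ → ℝ) : Monotone (quantile R G) := by
  intro v w hvw
  refine csInf_le_csInf ⟨_, quantile_bddBelow R hR G v⟩ ⟨R, Set.mem_insert _ _⟩ ?_
  exact Set.insert_subset_insert fun y hy => ⟨hy.1, hvw.trans hy.2⟩

lemma quantile_le_of_le {R : ℝ} (hR : 0 ≤ R) {G : ℝ → ℝ} {v c : ℝ} (hc : c ∈ Set.Icc (-R) R)
    (h : v ≤ G c) : quantile R G v ≤ c :=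
  csInf_le ⟨_, quantile_bddBelow R hR G v⟩ (Or.inr ⟨hc, h⟩)

lemma le_apply_quantile {R : ℝ} (hR : 0 ≤ R) {G : ℝ → ℝ} (hG : Continuous G) {v : ℝ}
    (hv : v ≤ G R) : v ≤ G (quantile R G v) := by
  have hset : insert R {y | y ∈ Set.Icc (-R) R ∧ v ≤ G y} = {y | y ∈ Set.Icc (-R) R ∧ v ≤ G y} := by
    refine Set.insert_eq_of_mem ⟨⟨by linarith, le_rfl⟩, hv⟩
  have hcl : IsClosed {y | y ∈ Set.Icc (-R) R ∧ v ≤ G y} :=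
    isClosed_Icc.inter (isClosed_le continuous_const hG)
  have := hcl.csInf_mem ⟨R, ⟨by linarith, le_rfl⟩, hv⟩ ⟨-R, fun y hy => hy.1.1⟩
  rw [← hset] at this
  rcases this with h | h
  · rw [quantile, h]; exact hv
  · exact h.2

lemma quantile_le_iff {R : ℝ} (hR : 0 ≤ R) {G : ℝ → ℝ} (hG : Continuous G) (hmono : Monotone G)
    {v c : ℝ} (hv : v ≤ G R) (hc : c ∈ Set.Icc (-R) R) : quantile R G v ≤ c ↔ v ≤ G c :=
  ⟨fun h => (le_apply_quantile hR hG hv).trans (hmono h), quantile_le_of_le hR hc⟩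

lemma apply_quantile {R : ℝ} (hR : 0 ≤ R) {G : ℝ → ℝ} (hG : Continuous G)
    {v : ℝ} (hv : v ≤ G R) (hv' : G (-R) ≤ v) : G (quantile R G v) = v := by
  refine le_antisymm ?_ (le_apply_quantile hR hG hv)
  rcases (quantile_mem hR G v).1.eq_or_lt with h | h
  · rw [← h]; exact hv'
  · have hne : (nhdsWithin (quantile R G v) (Set.Ioo (-R) (quantile R G v))).NeBot := by
      rw [nhdsWithin_Ioo_eq_nhdsLT h]; infer_instance
    refine le_of_tendsto (hG.continuousAt.tendsto.mono_left nhdsWithin_le_nhds :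
      Filter.Tendsto G (nhdsWithin (quantile R G v) (Set.Ioo (-R) (quantile R G v))) _) ?_
    filter_upwards [self_mem_nhdsWithin] with y hy
    by_contra hcon
    exact absurd (quantile_le_of_le hR ⟨hy.1.le, hy.2.le.trans (quantile_mem hR G v).2⟩
      (not_le.1 hcon).le) (not_le.2 hy.2)

/-- The derivative of a solution `T` of `G ∘ T = F`, for monotone `F`, `G`. -/
lemma hasDerivAt_of_comp_eq {F G T : ℝ → ℝ} (hF : Continuous F) (hG : Monotone G)
    (h : ∀ t, G (T t) = F t) {t f k : ℝ} (hk : 0 < k) (hFt : HasDerivAt F f t)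
    (hGt : HasDerivAt G k (T t)) : HasDerivAt T (f / k) t := by
  have hslope : ∀ᶠ y in nhdsWithin (T t) {T t}ᶜ, 0 < slope G (T t) y :=
    (hasDerivAt_iff_tendsto_slope.1 hGt).eventually (lt_mem_nhds hk)
  have hpos : ∀ᶠ y in nhds (T t), y ≠ T t → 0 < slope G (T t) y := by
    simpa [eventually_nhdsWithin_iff] using hslope
  have hcont : ContinuousAt T t := by
    refine tendsto_order.2 ⟨fun a ha => ?_, fun a ha => ?_⟩
    · obtain ⟨b, hb, hb'⟩ := ((nhdsLT_neBot (T t)).nonempty_of_mem (Filter.inter_mem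
        (Filter.inter_mem self_mem_nhdsWithin (Ioo_mem_nhdsLT ha))
          (mem_nhdsWithin_of_mem_nhds hpos)))
      have h1 := hb' hb.1.ne
      have hb1 : b < T t := hb.1
      have h2 : G b < G (T t) := by
        rw [slope_def_field] at h1
        rcases div_pos_iff.1 h1 with h2 | h2 <;> linarith [h2.1, h2.2]
      filter_upwards [hF.continuousAt.eventually (lt_mem_nhds (h t ▸ h2))] with s hs
      rw [← h s] at hs
      exact hb.2.1.trans (hG.reflect_lt hs)
    · obtain ⟨b, hb, hb'⟩ := ((nhdsGT_neBot (T t)).nonempty_of_mem (Filter.inter_mem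
        (Filter.inter_mem self_mem_nhdsWithin (Ioo_mem_nhdsGT ha))
          (mem_nhdsWithin_of_mem_nhds hpos)))
      have hb1 : T t < b := hb.1
      have h1 := hb' hb1.ne'
      have h2 : G (T t) < G b := by
        rw [slope_def_field] at h1
        have := (div_pos_iff_of_pos_right (sub_pos.2 hb1)).1 h1
        linarith
      filter_upwards [hF.continuousAt.eventually (gt_mem_nhds (h t ▸ h2))] with s hs
      rw [← h s] at hs
      exact (hG.reflect_lt hs).trans hb.2.2
  have hd : ContinuousAt (dslope G (T t)) (T t) :=
    continuousAt_dslope_same.2 hGt.differentiableAt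
  have hd0 : dslope G (T t) (T t) = k := by rw [dslope_same, hGt.deriv]
  have hdT : Filter.Tendsto (fun s => dslope G (T t) (T s)) (nhds t) (nhds k) := by
    have := hd.tendsto.comp hcont.tendsto
    rwa [hd0] at this
  rw [hasDerivAt_iff_tendsto_slope] at hFt ⊢
  have hlim := hFt.div (hdT.mono_left nhdsWithin_le_nhds) hk.ne'
  refine hlim.congr' ?_
  filter_upwards [self_mem_nhdsWithin,
    mem_nhdsWithin_of_mem_nhds (hdT.eventually (lt_mem_nhds hk))] with s hs hs'
  have key : F s - F t = dslope G (T t) (T s) * (T s - T t) := by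
    rw [← h s, ← h t]
    have := sub_smul_dslope G (T t) (T s)
    simp only [smul_eq_mul] at this
    linarith
  have hst : s - t ≠ 0 := sub_ne_zero.2 hs
  have hs0 : dslope G (T t) (T s) ≠ 0 := ne_of_gt hs'
  simp only [slope_def_field, Pi.div_apply]
  rw [key]
  field_simp

open ProbabilityTheory in
lemma continuous_cdf_of_ac (μ : Measure ℝ) [IsProbabilityMeasure μ] (h : μ ≪ volume) :
    Continuous (cdf μ) := by
  rw [continuous_iff_continuousAt]
  intro x
  rw [(cdf μ).mono.continuousAt_iff_leftLim_eq_rightLim, StieltjesFunction.rightLim_eq]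
  have h0 : (cdf μ).measure {x} = 0 := by rw [measure_cdf]; exact h (by simp)
  rw [StieltjesFunction.measure_singleton, ENNReal.ofReal_eq_zero, sub_nonpos] at h0
  exact le_antisymm ((cdf μ).mono.leftLim_le le_rfl) h0

open ProbabilityTheory in
/-- The probability integral transform. -/
lemma measure_cdf_le (μ : Measure ℝ) [IsProbabilityMeasure μ] (h : μ ≪ volume) {v : ℝ}
    (h0 : 0 ≤ v) (h1 : v ≤ 1) : μ {t | cdf μ t ≤ v} = ENNReal.ofReal v := by
  have hc := continuous_cdf_of_ac μ h
  rcases h1.eq_or_lt with rfl | h1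
  · have : {t | cdf μ t ≤ 1} = Set.univ := Set.eq_univ_of_forall fun t => cdf_le_one μ t
    rw [this]; simp
  obtain ⟨M, hM⟩ := ((tendsto_cdf_atTop μ).eventually (lt_mem_nhds h1)).exists
  have hbdd : BddAbove {t | cdf μ t ≤ v} := ⟨M, fun t ht =>
    ((cdf μ).mono.reflect_lt (lt_of_le_of_lt ht hM)).le⟩
  by_cases hne : {t | cdf μ t ≤ v}.Nonempty
  · have hcl : IsClosed {t | cdf μ t ≤ v} := isClosed_le hc continuous_const
    have hmem := hcl.csSup_mem hne hbdd
    set s := sSup {t | cdf μ t ≤ v}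
    have hset : {t | cdf μ t ≤ v} = Set.Iic s := by
      ext t
      exact ⟨fun ht => le_csSup hbdd ht, fun ht => ((cdf μ).mono ht).trans hmem⟩
    have hs : cdf μ s = v := by
      refine le_antisymm hmem ?_
      refine ge_of_tendsto (hc.continuousAt.tendsto.mono_left nhdsWithin_le_nhds :
        Filter.Tendsto (cdf μ) (nhdsWithin s (Set.Ioi s)) _) ?_
      filter_upwards [self_mem_nhdsWithin] with t ht
      by_contra hcon
      exact absurd (le_csSup hbdd (not_le.1 hcon).le) (not_le.2 ht)
    rw [hset, ← ofReal_cdf, hs]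
  · rw [Set.not_nonempty_iff_eq_empty] at hne
    rw [hne, measure_empty, eq_comm, ENNReal.ofReal_eq_zero]
    refine ge_of_tendsto (tendsto_cdf_atBot μ) (Filter.Eventually.of_forall fun t => ?_)
    by_contra hcon
    exact absurd (show t ∈ {t | cdf μ t ≤ v} from (not_le.1 hcon).le) (by rw [hne]; simp)

open ProbabilityTheory in
/-- Monotone rearrangement of `μ` onto `ν`. -/
def rearr (R : ℝ) (μ ν : Measure ℝ) (t : ℝ) : ℝ := quantile R (cdf ν) (cdf μ t)

open ProbabilityTheory in
lemma cdf_of_supp {R : ℝ} {ν : Measure ℝ} [IsProbabilityMeasure ν]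
    (hν : ν ≪ volume) (hsupp : ν (Set.Icc (-R) R)ᶜ = 0) : cdf ν (-R) = 0 ∧ cdf ν R = 1 := by
  constructor
  · rw [cdf_eq_real, measureReal_def]
    have : ν (Set.Iic (-R)) = 0 := by
      refine measure_mono_null (t := (Set.Icc (-R) R)ᶜ ∪ {-R}) (fun x hx => ?_)
        (measure_union_null hsupp (hν (by simp)))
      rcases (show x ≤ -R from hx).eq_or_lt with h | h
      · exact Or.inr h
      · exact Or.inl fun h' => absurd h'.1 (not_le.2 h)
    simp [this]
  · rw [cdf_eq_real, measureReal_def]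
    have : ν (Set.Iic R) = 1 := by
      rw [← prob_compl_eq_zero_iff measurableSet_Iic]
      exact measure_mono_null (Set.compl_subset_compl.2 fun x hx => hx.2) hsupp
    simp [this]

open ProbabilityTheory in
lemma map_rearr {R : ℝ} (hR : 0 ≤ R) {μ ν : Measure ℝ} [IsProbabilityMeasure μ]
    [IsProbabilityMeasure ν] (hμ : μ ≪ volume) (hν : ν ≪ volume)
    (hsupp : ν (Set.Icc (-R) R)ᶜ = 0) : μ.map (rearr R μ ν) = ν := by
  obtain ⟨-, hR1⟩ := cdf_of_supp hν hsupp
  have hmono : Monotone (rearr R μ ν) := (quantile_mono hR _).comp (cdf μ).mono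
  have := Measure.isProbabilityMeasure_map (μ := μ) hmono.measurable.aemeasurable
  refine Measure.ext_of_Iic _ _ fun c => ?_
  rw [Measure.map_apply hmono.measurable measurableSet_Iic]
  rcases lt_or_ge c (-R) with hc | hc
  · have h1 : rearr R μ ν ⁻¹' Set.Iic c = ∅ := by
      ext t; simp only [Set.mem_preimage, Set.mem_Iic, Set.mem_empty_iff_false, iff_false, not_le]
      exact hc.trans_le (quantile_mem hR _ _).1
    rw [h1, measure_empty, eq_comm]
    have h2 : Set.Iic c ⊆ (Set.Icc (-R) R)ᶜ := fun x hx h' =>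
      absurd (h'.1.trans hx) (not_le.2 hc)
    exact measure_mono_null h2 hsupp
  rcases le_or_gt c R with hc' | hc'
  · have h1 : rearr R μ ν ⁻¹' Set.Iic c = {t | cdf μ t ≤ cdf ν c} := by
      ext t
      exact quantile_le_iff hR (continuous_cdf_of_ac ν hν) (cdf ν).mono
        (hR1.symm ▸ cdf_le_one μ t) ⟨hc, hc'⟩
    rw [h1, measure_cdf_le μ hμ (cdf_nonneg ν c) (cdf_le_one ν c), ofReal_cdf]
  · have h1 : rearr R μ ν ⁻¹' Set.Iic c = Set.univ :=
      Set.eq_univ_of_forall fun t => (quantile_mem hR _ _).2.trans hc'.le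
    rw [h1, measure_univ, eq_comm, ← prob_compl_eq_zero_iff measurableSet_Iic]
    exact measure_mono_null (Set.compl_subset_compl.2 fun x hx => hx.2.trans hc'.le) hsupp

open ProbabilityTheory in
lemma ae_hasDerivAt_cdf {f : ℝ → ℝ≥0∞} (hf : Measurable f)
    [IsProbabilityMeasure (volume.withDensity f)] :
    ∀ᵐ t, HasDerivAt (cdf (volume.withDensity f)) (f t).toReal t := by
  have h := (cdf (volume.withDensity f)).ae_hasDerivAt
  rw [measure_cdf] at h
  filter_upwards [h, Measure.rnDeriv_withDensity volume hf] with t h1 h2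
  rwa [h2] at h1

open ProbabilityTheory in
lemma ae_hasDerivAt_rearr {R : ℝ} (hR : 0 ≤ R) {f k : ℝ → ℝ≥0∞} (hf : Measurable f)
    (hk : Measurable k) [IsProbabilityMeasure (volume.withDensity f)]
    [IsProbabilityMeasure (volume.withDensity k)]
    (hsupp : volume.withDensity k (Set.Icc (-R) R)ᶜ = 0) :
    ∀ᵐ t ∂(volume.withDensity f),
      k (rearr R (volume.withDensity f) (volume.withDensity k) t) ≠ 0 ∧
      k (rearr R (volume.withDensity f) (volume.withDensity k) t) ≠ ∞ ∧
      HasDerivAt (rearr R (volume.withDensity f) (volume.withDensity k))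
        (f t / k (rearr R (volume.withDensity f) (volume.withDensity k) t)).toReal t := by
  set μ := volume.withDensity f
  set ν := volume.withDensity k
  have hμ : μ ≪ volume := withDensity_absolutelyContinuous _ _
  have hν : ν ≪ volume := withDensity_absolutelyContinuous _ _
  obtain ⟨hR0, hR1⟩ := cdf_of_supp hν hsupp
  have hmono : Monotone (rearr R μ ν) := (quantile_mono hR _).comp (cdf μ).mono
  have hk0 : ∀ᵐ y ∂ν, k y ≠ 0 := by
    rw [ae_withDensity_iff hk]; exact Filter.Eventually.of_forall fun _ h => h
  have hktop : ∀ᵐ y ∂ν, k y ≠ ∞ := by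
    refine hν.ae_le ?_
    refine (ae_lt_top hk ?_).mono fun y hy => hy.ne
    have : ν Set.univ = 1 := measure_univ
    rw [withDensity_apply _ MeasurableSet.univ, setLIntegral_univ] at this
    simp [this]
  have hGd := hν.ae_le (ae_hasDerivAt_cdf hk)
  have hall := hk0.and (hktop.and hGd)
  rw [← map_rearr hR hμ hν hsupp] at hall
  have hpull := ae_of_ae_map hmono.measurable.aemeasurable hall
  filter_upwards [hpull, hμ.ae_le (ae_hasDerivAt_cdf hf)] with t ht hFt
  refine ⟨ht.1, ht.2.1, ?_⟩
  rw [ENNReal.toReal_div]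
  refine hasDerivAt_of_comp_eq (continuous_cdf_of_ac μ hμ) (cdf ν).mono (fun s => ?_)
    (ENNReal.toReal_pos ht.1 ht.2.1) hFt ht.2.2
  exact apply_quantile hR (continuous_cdf_of_ac ν hν) (hR1.symm ▸ cdf_le_one μ s)
    (hR0.symm ▸ cdf_nonneg μ s)

/-! ### Triangular transport -/

open ProbabilityTheory in
lemma measurable_quantile {Ω : Type*} [MeasurableSpace Ω] {R : ℝ} (hR : 0 ≤ R) {G : Ω → ℝ → ℝ}
    {v : Ω → ℝ} (hGm : ∀ y, Measurable fun ω => G ω y) (hv : Measurable v)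
    (hG : ∀ ω, Continuous (G ω)) (hmono : ∀ ω, Monotone (G ω)) (hvR : ∀ ω, v ω ≤ G ω R) :
    Measurable fun ω => quantile R (G ω) (v ω) := by
  refine measurable_of_Iic fun c => ?_
  rcases lt_or_ge c (-R) with hc | hc
  · convert MeasurableSet.empty using 1
    ext ω
    simpa using hc.trans_le (quantile_mem hR (G ω) (v ω)).1
  rcases le_or_gt c R with hc' | hc'
  · convert measurableSet_le hv (hGm c) using 1
    ext ω
    exact quantile_le_iff hR (hG ω) (hmono ω) (hvR ω) ⟨hc, hc'⟩
  · convert MeasurableSet.univ using 1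
    exact Set.eq_univ_of_forall fun ω => (quantile_mem hR (G ω) (v ω)).2.trans hc'.le

lemma measurable_finCons {n : ℕ} :
    Measurable fun z : (Fin n → ℝ) × ℝ => (Fin.cons z.2 z.1 : Fin (n + 1) → ℝ) := by
  refine measurable_pi_iff.2 fun i => ?_
  refine Fin.cases ?_ (fun j => ?_) i
  · simpa using measurable_snd
  · exact (measurable_pi_apply j).comp measurable_fst

lemma measurable_finTail {n : ℕ} : Measurable fun x : Fin (n + 1) → ℝ => Fin.tail x :=
  measurable_pi_iff.2 fun j => measurable_pi_apply j.succ

lemma measurePreserving_finCons (n : ℕ) :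
    MeasurePreserving (fun z : (Fin n → ℝ) × ℝ => (Fin.cons z.2 z.1 : Fin (n + 1) → ℝ)) := by
  have h := ((volume_preserving_piFinSuccAbove (fun _ : Fin (n + 1) => ℝ) 0).symm).comp
    (Measure.measurePreserving_swap (μ := (volume : Measure (Fin n → ℝ)))
      (ν := (volume : Measure ℝ)))
  rw [← Measure.volume_eq_prod] at h
  convert h using 1
  funext z
  simp [MeasurableEquiv.piFinSuccAbove, Fin.insertNthEquiv]

lemma lintegral_finCons {n : ℕ} {h : (Fin (n + 1) → ℝ) → ℝ≥0∞} (hh : Measurable h) :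
    ∫⁻ x, h x = ∫⁻ a : Fin n → ℝ, ∫⁻ t : ℝ, h (Fin.cons t a) := by
  rw [← (measurePreserving_finCons n).lintegral_comp hh, Measure.volume_eq_prod]
  exact lintegral_prod _ (hh.comp measurable_finCons).aemeasurable

/-- A normalized conditional density. -/
lemma exists_condDensity {A : Type*} [MeasurableSpace A] (μ : Measure A) {R : ℝ} (hR : 1 ≤ R)
    {p : A → ℝ → ℝ≥0∞} (hp : Measurable (Function.uncurry p)) (hfin : ∫⁻ a, (∫⁻ t, p a t) ∂μ ≠ ∞) :
    ∃ f : A → ℝ → ℝ≥0∞, Measurable (Function.uncurry f) ∧ (∀ a, ∫⁻ t, f a t = 1) ∧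
      (∀ a, (∀ t ∉ Set.Icc (-R) R, p a t = 0) → ∀ t ∉ Set.Icc (-R) R, f a t = 0) ∧
      ∀ᵐ a ∂μ, ∀ᵐ t, p a t = (∫⁻ s, p a s) * f a t := by
  classical
  have hm : Measurable fun a => ∫⁻ t, p a t := hp.lintegral_prod_right
  set m := fun a => ∫⁻ t, p a t with hmdef
  have hS : MeasurableSet {a | m a ≠ 0 ∧ m a ≠ ∞} :=
    (hm (measurableSet_singleton 0).compl).inter (hm (measurableSet_singleton ∞).compl)
  refine ⟨fun a t => if m a ≠ 0 ∧ m a ≠ ∞ then p a t / m a else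
    (Set.Icc (0 : ℝ) 1).indicator (fun _ => (1 : ℝ≥0∞)) t, ?_, ?_, ?_, ?_⟩
  · refine Measurable.ite (measurable_fst hS) (hp.div (hm.comp measurable_fst)) ?_
    exact (measurable_const.indicator measurableSet_Icc).comp measurable_snd
  · intro a
    by_cases h : m a ≠ 0 ∧ m a ≠ ∞
    · simp only [h, ne_eq, not_false_eq_true, and_self, if_true]
      simp only [div_eq_mul_inv]
      rw [lintegral_mul_const _ (show Measurable (p a) from hp.comp measurable_prodMk_left)]
      exact ENNReal.mul_inv_cancel h.1 h.2
    · simp only [h, if_false]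
      rw [lintegral_indicator measurableSet_Icc]
      simp
  · intro a ha t ht
    dsimp only
    split_ifs with h
    · rw [ha t ht, ENNReal.zero_div]
    · exact Set.indicator_of_notMem (fun h' => ht ⟨by linarith [h'.1], h'.2.trans hR⟩) _
  · filter_upwards [ae_lt_top hm hfin] with a ha
    by_cases h : m a = 0
    · have h0 : (fun t => p a t) =ᵐ[volume] 0 :=
        (lintegral_eq_zero_iff (hp.comp measurable_prodMk_left)).1 h
      filter_upwards [h0] with t ht
      rw [ht, show ∫⁻ s, p a s = 0 from h]; simp
    · refine Filter.Eventually.of_forall fun t => ?_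
      simp only [h, ha.ne, ne_eq, not_false_eq_true, and_self, if_true]
      exact (ENNReal.mul_div_cancel h ha.ne).symm

open ProbabilityTheory in
lemma measurable_cdf_withDensity {A : Type*} [MeasurableSpace A] {f : A → ℝ → ℝ≥0∞}
    (hf : Measurable (Function.uncurry f))
    (h1 : ∀ a, IsProbabilityMeasure (volume.withDensity (f a))) :
    Measurable fun z : A × ℝ => cdf (volume.withDensity (f z.1)) z.2 := by
  have : ∀ z : A × ℝ, cdf (volume.withDensity (f z.1)) z.2 =
      (∫⁻ s, {w : (A × ℝ) × ℝ | w.2 ≤ w.1.2}.indicator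
        (fun w : (A × ℝ) × ℝ => f w.1.1 w.2) (z, s)).toReal := by
    intro z
    have := h1 z.1
    rw [cdf_eq_real, measureReal_def, withDensity_apply _ measurableSet_Iic,
      ← lintegral_indicator measurableSet_Iic]
    congr 1
  simp_rw [this]
  refine Measurable.ennreal_toReal (Measurable.lintegral_prod_right' ?_)
  refine Measurable.indicator ?_
    (measurableSet_le measurable_snd (measurable_snd.comp measurable_fst))
  exact hf.comp ((measurable_fst.comp measurable_fst).prodMk measurable_snd)

lemma isProbabilityMeasure_withDensity_of {A : Type*} [MeasurableSpace A] {μ : Measure A}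
    {f : A → ℝ≥0∞} (h : ∫⁻ a, f a ∂μ = 1) : IsProbabilityMeasure (μ.withDensity f) :=
  ⟨by rw [withDensity_apply _ MeasurableSet.univ, setLIntegral_univ, h]⟩

lemma map_tail_withDensity {n : ℕ} {p : (Fin (n + 1) → ℝ) → ℝ≥0∞} (hp : Measurable p) :
    (volume.withDensity p).map (fun x => Fin.tail x) =
      (volume : Measure (Fin n → ℝ)).withDensity fun a => ∫⁻ t, p (Fin.cons t a) := by
  refine Measure.ext fun B hB => ?_
  rw [Measure.map_apply measurable_finTail hB, withDensity_apply _ (measurable_finTail hB),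
    withDensity_apply _ hB, ← lintegral_indicator (measurable_finTail hB),
    ← lintegral_indicator hB, lintegral_finCons (hp.indicator (measurable_finTail hB))]
  refine lintegral_congr fun a => ?_
  by_cases ha : a ∈ B <;> simp [Set.indicator, ha]

/-- The property, for a density `p`, that `ℓ i ζ` bounds the `p`-mean of the partial derivative
`∂ᵢζ` of every bounded function `ζ` that is monotone in the `i`-th variable. -/
def BoundsMonotoneDeriv {n : ℕ} (R : ℝ) (p : (Fin n → ℝ) → ℝ≥0∞)
    (ℓ : Fin n → ((Fin n → ℝ) → ℝ) → ℝ) : Prop :=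
  ∀ (i : Fin n) (ζ : (Fin n → ℝ) → ℝ) (r : (Fin n → ℝ) → ℝ), Measurable ζ → Measurable r →
    (∀ x, ζ x ∈ Set.Icc (-R) R) → (∀ x, Monotone fun s => ζ (Function.update x i s)) →
    (∀ᵐ x ∂(volume.withDensity p), Filter.Tendsto (fun m : ℕ => ((m : ℝ) + 1) *
      (ζ (Function.update x i (x i + 1 / ((m : ℝ) + 1))) - ζ x)) Filter.atTop (nhds (r x))) →
    ∫⁻ x, p x * ENNReal.ofReal (r x) ≤ ENNReal.ofReal (ℓ i ζ)

lemma BoundsMonotoneDeriv.tail {n : ℕ} {R : ℝ} {p : (Fin (n + 1) → ℝ) → ℝ≥0∞} (hp : Measurable p)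
    {ℓ : Fin (n + 1) → ((Fin (n + 1) → ℝ) → ℝ) → ℝ} (h : BoundsMonotoneDeriv R p ℓ) :
    BoundsMonotoneDeriv R (fun a => ∫⁻ t, p (Fin.cons t a))
      (fun i ζ => ℓ i.succ fun x => ζ (Fin.tail x)) := by
  intro i ζ r hζ hr hb hm hd
  have hp' : Measurable fun z : (Fin n → ℝ) × ℝ => p (Fin.cons z.2 z.1) :=
    hp.comp measurable_finCons
  have hpm : Measurable fun a : Fin n → ℝ => ∫⁻ t, p (Fin.cons t a) := hp'.lintegral_prod_right'
  have := h i.succ (fun x => ζ (Fin.tail x)) (fun x => r (Fin.tail x)) (hζ.comp measurable_finTail)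
    (hr.comp measurable_finTail) (fun x => hb _) (fun x => ?_) ?_
  · refine le_trans (le_of_eq ?_) this
    rw [lintegral_finCons (h := fun x => p x * ENNReal.ofReal (r (Fin.tail x)))
      (hp.mul (hr.comp measurable_finTail).ennreal_ofReal)]
    refine lintegral_congr fun a => ?_
    simp only [Fin.tail_cons]
    exact (lintegral_mul_const _ (hp'.comp measurable_prodMk_left)).symm
  · simp only [Fin.tail_update_succ]
    exact hm _
  · rw [← map_tail_withDensity hp] at hd
    simp only [Fin.tail_update_succ]
    exact ae_of_ae_map measurable_finTail.aemeasurable hd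

open ProbabilityTheory in
lemma measurable_rearr {A : Type*} [MeasurableSpace A] {R : ℝ} (hR : 0 ≤ R)
    {f k : A → ℝ → ℝ≥0∞} (hf : Measurable (Function.uncurry f))
    (hk : Measurable (Function.uncurry k))
    (hf1 : ∀ a, IsProbabilityMeasure (volume.withDensity (f a)))
    (hk1 : ∀ a, IsProbabilityMeasure (volume.withDensity (k a)))
    (hsupp : ∀ a, volume.withDensity (k a) (Set.Icc (-R) R)ᶜ = 0) :
    Measurable fun z : A × ℝ =>
      rearr R (volume.withDensity (f z.1)) (volume.withDensity (k z.1)) z.2 := by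
  have hac : ∀ g : ℝ → ℝ≥0∞, volume.withDensity g ≪ volume := fun g =>
    withDensity_absolutelyContinuous _ _
  refine measurable_quantile hR
    (G := fun z : A × ℝ => cdf (volume.withDensity (k z.1)))
    (v := fun z => cdf (volume.withDensity (f z.1)) z.2) (fun y => ?_)
    (measurable_cdf_withDensity hf hf1) (fun z => continuous_cdf_of_ac _ (hac _))
    (fun z => (cdf _).mono) (fun z => ?_)
  · exact (measurable_cdf_withDensity hk hk1).comp (measurable_fst.prodMk measurable_const)
  · rw [(cdf_of_supp (hac _) (hsupp z.1)).2]
    exact cdf_le_one _ _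

lemma lintegral_disintegrate {n : ℕ} {p : (Fin (n + 1) → ℝ) → ℝ≥0∞} (hp : Measurable p)
    {f : (Fin n → ℝ) → ℝ → ℝ≥0∞} (hf : Measurable (Function.uncurry f))
    (hpf : ∀ᵐ a : Fin n → ℝ, ∀ᵐ t : ℝ, p (Fin.cons t a) = (∫⁻ s, p (Fin.cons s a)) * f a t)
    {h : (Fin (n + 1) → ℝ) → ℝ≥0∞} (hh : Measurable h) :
    ∫⁻ x, h x ∂(volume.withDensity p) =
      ∫⁻ a, ∫⁻ t, h (Fin.cons t a) ∂(volume.withDensity (f a))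
        ∂(volume.withDensity fun a : Fin n → ℝ => ∫⁻ t, p (Fin.cons t a)) := by
  have hp'm : Measurable fun a : Fin n → ℝ => ∫⁻ t, p (Fin.cons t a) :=
    (hp.comp measurable_finCons).lintegral_prod_right'
  have hfa : ∀ a, Measurable (f a) := fun a => hf.comp measurable_prodMk_left
  have hha : ∀ a, Measurable fun t => h (Fin.cons t a) := fun a =>
    (hh.comp measurable_finCons).comp measurable_prodMk_left
  have hin : ∀ a, ∫⁻ t, h (Fin.cons t a) ∂(volume.withDensity (f a)) =
      ∫⁻ t, f a t * h (Fin.cons t a) := fun a =>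
    lintegral_withDensity_eq_lintegral_mul _ (hfa a) (hha a)
  have hm : Measurable fun a => ∫⁻ t, f a t * h (Fin.cons t a) :=
    (hf.mul (hh.comp measurable_finCons)).lintegral_prod_right'
  simp_rw [hin]
  rw [lintegral_withDensity_eq_lintegral_mul _ hp hh,
    lintegral_withDensity_eq_lintegral_mul _ hp'm hm, lintegral_finCons (hp.mul hh)]
  refine lintegral_congr_ae ?_
  filter_upwards [hpf] with a ha
  refine Eq.trans ?_ (lintegral_const_mul _ ((hfa a).mul (hha a)))
  refine lintegral_congr_ae ?_
  filter_upwards [ha] with t ht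
  simp only [Pi.mul_apply]
  rw [ht, mul_assoc]

lemma ae_of_disintegrate {n : ℕ} {p : (Fin (n + 1) → ℝ) → ℝ≥0∞} (hp : Measurable p)
    {f : (Fin n → ℝ) → ℝ → ℝ≥0∞} (hf : Measurable (Function.uncurry f))
    (hpf : ∀ᵐ a : Fin n → ℝ, ∀ᵐ t : ℝ, p (Fin.cons t a) = (∫⁻ s, p (Fin.cons s a)) * f a t)
    {P : (Fin (n + 1) → ℝ) → Prop} (hP : MeasurableSet {x | P x})
    (h : ∀ᵐ a ∂(volume.withDensity fun a : Fin n → ℝ => ∫⁻ t, p (Fin.cons t a)),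
          ∀ᵐ t ∂(volume.withDensity (f a)), P (Fin.cons t a)) :
    ∀ᵐ x ∂(volume.withDensity p), P x := by
  have hm : Measurable ({x | P x}ᶜ.indicator fun _ => (1 : ℝ≥0∞)) :=
    measurable_const.indicator hP.compl
  have h1 := lintegral_disintegrate hp hf hpf hm
  rw [lintegral_indicator_const hP.compl, one_mul] at h1
  rw [ae_iff]
  refine h1.trans ?_
  rw [← lintegral_zero (μ := volume.withDensity fun a : Fin n → ℝ => ∫⁻ t, p (Fin.cons t a))]
  refine lintegral_congr_ae ?_
  filter_upwards [h] with a ha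
  rw [← lintegral_zero (μ := volume.withDensity (f a))]
  refine lintegral_congr_ae ?_
  filter_upwards [ha] with t ht
  exact Set.indicator_of_notMem (s := {x | P x}ᶜ) (fun h' => h' ht) _

lemma tendsto_one_div_nhdsNE : Filter.Tendsto (fun m : ℕ => 1 / ((m : ℝ) + 1)) Filter.atTop
    (nhdsWithin 0 {0}ᶜ) :=
  tendsto_nhdsWithin_iff.2 ⟨tendsto_one_div_add_atTop_nhds_zero_nat,
    Filter.Eventually.of_forall fun m => (Nat.one_div_pos_of_nat (n := m)).ne'⟩

lemma _root_.HasDerivAt.tendsto_mul_sub_one_div {f : ℝ → ℝ} {f' x : ℝ} (h : HasDerivAt f f' x) :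
    Filter.Tendsto (fun m : ℕ => ((m : ℝ) + 1) * (f (x + 1 / ((m : ℝ) + 1)) - f x)) Filter.atTop
      (nhds f') := by
  have := h.tendsto_slope_zero.comp tendsto_one_div_nhdsNE
  simpa [Function.comp_def] using this


open ProbabilityTheory in
/-- Triangular transport of a density `p` onto a boundedly supported density `q`, together with
bounds for the diagonal entries of its Jacobian matrix. -/
theorem exists_triangular_transport {n : ℕ} {R : ℝ} (hR : 1 ≤ R) :
    ∀ {p q : (Fin n → ℝ) → ℝ≥0∞} {ℓ : Fin n → ((Fin n → ℝ) → ℝ) → ℝ},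
    Measurable p → Measurable q → ∫⁻ x, p x = 1 → ∫⁻ x, q x = 1 →
    (∀ x, q x ≠ 0 → ∀ i, x i ∈ Set.Icc (-R) R) → BoundsMonotoneDeriv R p ℓ →
    ∃ (S : (Fin n → ℝ) → (Fin n → ℝ)) (r : Fin n → (Fin n → ℝ) → ℝ),
      Measurable S ∧ (∀ i, Measurable (r i)) ∧ (∀ i x, 0 ≤ r i x) ∧
      (∀ x i, S x i ∈ Set.Icc (-R) R) ∧
      (volume.withDensity p).map S = volume.withDensity q ∧
      (∀ i, ∫⁻ x, p x * ENNReal.ofReal (r i x) ≤ ENNReal.ofReal (ℓ i fun x => S x i)) ∧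
      ∀ᵐ x ∂(volume.withDensity p), p x = q (S x) * ∏ i, ENNReal.ofReal (r i x) := by
  have hR0 : 0 ≤ R := zero_le_one.trans hR
  induction n with
  | zero =>
    intro p q ℓ hp hq hp1 hq1 _ _
    have hpq : p = q := by
      funext x
      have h1 : ∀ f : (Fin 0 → ℝ) → ℝ≥0∞, ∫⁻ x, f x = f x := fun f => by
        rw [volume_pi, Measure.pi_of_empty (x := x), lintegral_dirac]
      rw [h1] at hp1 hq1
      rw [hp1, hq1]
    refine ⟨id, fun i => i.elim0, measurable_id, fun i => i.elim0, fun i => i.elim0,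
      fun _ i => i.elim0, ?_, fun i => i.elim0, ?_⟩
    · rw [Measure.map_id, hpq]
    · exact Filter.Eventually.of_forall fun x => by simp [hpq]
  | succ n ih =>
    intro p q ℓ hp hq hp1 hq1 hsupp hℓ
    have hpc : Measurable (Function.uncurry fun (a : Fin n → ℝ) (t : ℝ) => p (Fin.cons t a)) :=
      hp.comp measurable_finCons
    have hqc : Measurable (Function.uncurry fun (a : Fin n → ℝ) (t : ℝ) => q (Fin.cons t a)) :=
      hq.comp measurable_finCons
    have hp'm : Measurable fun a : Fin n → ℝ => ∫⁻ t, p (Fin.cons t a) := hpc.lintegral_prod_right'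
    have hq'm : Measurable fun a : Fin n → ℝ => ∫⁻ t, q (Fin.cons t a) := hqc.lintegral_prod_right'
    have hp'1 : ∫⁻ a : Fin n → ℝ, ∫⁻ t, p (Fin.cons t a) = 1 := by rw [← lintegral_finCons hp, hp1]
    have hq'1 : ∫⁻ a : Fin n → ℝ, ∫⁻ t, q (Fin.cons t a) = 1 := by rw [← lintegral_finCons hq, hq1]
    obtain ⟨S, r, hS, hrm, hr0, hSb, hSmap, hrint, hrae⟩ := ih hp'm hq'm hp'1 hq'1 (fun a ha i => by
      by_contra hcon
      refine ha ?_
      rw [← lintegral_zero (μ := (volume : Measure ℝ))]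
      refine lintegral_congr fun t => ?_
      by_contra h
      have := hsupp _ h i.succ
      rw [Fin.cons_succ] at this
      exact hcon this) (hℓ.tail hp)
    obtain ⟨f, hf, hf1, -, hpf⟩ := exists_condDensity (volume : Measure (Fin n → ℝ)) hR hpc
      (by rw [hp'1]; exact one_ne_top)
    obtain ⟨k, hk, hk1, hksupp, hqk⟩ := exists_condDensity (volume : Measure (Fin n → ℝ)) hR hqc
      (by rw [hq'1]; exact one_ne_top)
    have hksupp' : ∀ b, volume.withDensity (k b) (Set.Icc (-R) R)ᶜ = 0 := by
      intro b
      rw [withDensity_apply _ measurableSet_Icc.compl, setLIntegral_eq_zero_iff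
        measurableSet_Icc.compl (show Measurable (k b) from hk.comp measurable_prodMk_left)]
      refine Filter.Eventually.of_forall fun t ht => hksupp b (fun t ht => ?_) t ht
      by_contra h
      exact ht (by simpa using hsupp _ h 0)
    have hμ : ∀ a, IsProbabilityMeasure (volume.withDensity (f a)) := fun a =>
      isProbabilityMeasure_withDensity_of (hf1 a)
    have hν : ∀ b, IsProbabilityMeasure (volume.withDensity (k b)) := fun b =>
      isProbabilityMeasure_withDensity_of (hk1 b)
    have hac : ∀ g : ℝ → ℝ≥0∞, volume.withDensity g ≪ volume := fun g =>
      withDensity_absolutelyContinuous _ _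
    obtain ⟨T, hTm, hTb, hTmono, hTmap, hTd⟩ : ∃ T : (Fin n → ℝ) → ℝ → ℝ,
        Measurable (Function.uncurry T) ∧ (∀ a t, T a t ∈ Set.Icc (-R) R) ∧ (∀ a, Monotone (T a)) ∧
        (∀ a, (volume.withDensity (f a)).map (T a) = volume.withDensity (k (S a))) ∧
        (∀ a, ∀ᵐ t ∂(volume.withDensity (f a)), k (S a) (T a t) ≠ 0 ∧
          k (S a) (T a t) ≠ ∞ ∧ HasDerivAt (T a) (f a t / k (S a) (T a t)).toReal t) := by
      refine ⟨fun a t => rearr R (volume.withDensity (f a)) (volume.withDensity (k (S a))) t,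
        ?_, fun a t => quantile_mem hR0 _ _, fun a => (quantile_mono hR0 _).comp (cdf _).mono,
        fun a => map_rearr hR0 (hac _) (hac _) (hksupp' _), fun a => ?_⟩
      · refine measurable_rearr (k := fun a => k (S a)) hR0 hf ?_ hμ (fun a => hν _)
          fun a => hksupp' _
        exact hk.comp ((hS.comp measurable_fst).prodMk measurable_snd)
      · have h1 : Measurable (f a) := hf.comp measurable_prodMk_left
        have h2 : Measurable (k (S a)) := hk.comp measurable_prodMk_left
        exact ae_hasDerivAt_rearr hR0 h1 h2 (hksupp' (S a))
    have hTa : ∀ a, Measurable (T a) := fun a => hTm.comp measurable_prodMk_left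
    have hpair : Measurable fun x : Fin (n + 1) → ℝ => (Fin.tail x, x 0) :=
      measurable_finTail.prodMk (measurable_pi_apply 0)
    set S₁ : (Fin (n + 1) → ℝ) → (Fin (n + 1) → ℝ) := fun x =>
      Fin.cons (T (Fin.tail x) (x 0)) (S (Fin.tail x)) with hS₁
    have hT₁m : Measurable fun x : Fin (n + 1) → ℝ => T (Fin.tail x) (x 0) := hTm.comp hpair
    have hS₁m : Measurable S₁ :=
      measurable_finCons.comp ((hS.comp measurable_finTail).prodMk hT₁m)
    set r₀ : (Fin (n + 1) → ℝ) → ℝ := fun x =>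
      (f (Fin.tail x) (x 0) / k (S (Fin.tail x)) (T (Fin.tail x) (x 0))).toReal with hr₀
    have hr₀m : Measurable r₀ := by
      refine Measurable.ennreal_toReal (Measurable.div (hf.comp hpair) ?_)
      exact hk.comp ((hS.comp measurable_finTail).prodMk hT₁m)
    have hcons : ∀ b : Fin n → ℝ, Measurable fun t : ℝ => (Fin.cons t b : Fin (n + 1) → ℝ) :=
      fun b => measurable_finCons.comp measurable_prodMk_left
    have hS₁cons : ∀ t a, S₁ (Fin.cons t a) = Fin.cons (T a t) (S a) := fun t a => by
      simp only [hS₁, Fin.tail_cons, Fin.cons_zero]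
    have hmap : (volume.withDensity p).map S₁ = volume.withDensity q := by
      refine Measure.ext_of_lintegral _ fun h hh => ?_
      have hin : ∀ a, ∫⁻ t, h (S₁ (Fin.cons t a)) ∂(volume.withDensity (f a)) =
          ∫⁻ t, h (Fin.cons t (S a)) ∂(volume.withDensity (k (S a))) := by
        intro a
        rw [← hTmap a, lintegral_map (f := fun t => h (Fin.cons t (S a)))
          (hh.comp (hcons _)) (hTa a)]
        simp_rw [hS₁cons]
      have hmeas : Measurable fun b : Fin n → ℝ =>
          ∫⁻ t, h (Fin.cons t b) ∂(volume.withDensity (k b)) := by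
        have : ∀ b : Fin n → ℝ, ∫⁻ t, h (Fin.cons t b) ∂(volume.withDensity (k b)) =
            ∫⁻ t, k b t * h (Fin.cons t b) := fun b =>
          lintegral_withDensity_eq_lintegral_mul _
            (show Measurable (k b) from hk.comp measurable_prodMk_left) (hh.comp (hcons b))
        simp_rw [this]
        exact (hk.mul (hh.comp measurable_finCons)).lintegral_prod_right'
      rw [lintegral_map hh hS₁m, lintegral_disintegrate (h := fun x => h (S₁ x)) hp hf hpf
        (hh.comp hS₁m),
        lintegral_disintegrate hq hk hqk hh, ← hSmap, lintegral_map hmeas hS]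
      exact lintegral_congr hin
    have hupd : ∀ (x : Fin (n + 1) → ℝ) (s : ℝ),
        S₁ (Function.update x 0 s) 0 = T (Fin.tail x) s := by
      intro x s
      simp only [hS₁, Fin.cons_zero, Function.update_self, Fin.tail_update_zero]
    have hderiv : ∀ᵐ x ∂(volume.withDensity p), Filter.Tendsto (fun m : ℕ => ((m : ℝ) + 1) *
        (S₁ (Function.update x 0 (x 0 + 1 / ((m : ℝ) + 1))) 0 - S₁ x 0)) Filter.atTop
        (nhds (r₀ x)) := by
      refine ae_of_disintegrate hp hf hpf ?_ ?_
      · refine measurableSet_tendsto_fun (fun m => ?_) hr₀m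
        simp only [hupd]
        have h1 : Measurable fun x : Fin (n + 1) → ℝ => x 0 + 1 / ((m : ℝ) + 1) :=
          (measurable_pi_apply 0).add_const _
        exact ((hTm.comp (measurable_finTail.prodMk h1)).sub
          ((measurable_pi_apply 0).comp hS₁m)).const_mul _
      · refine Filter.Eventually.of_forall fun a => ?_
        filter_upwards [hTd a] with t ht
        simp only [hupd, Fin.tail_cons, Fin.cons_zero, hS₁cons, hr₀]
        exact ht.2.2.tendsto_mul_sub_one_div
    refine ⟨S₁, Fin.cons r₀ fun i x => r i (Fin.tail x), hS₁m, ?_, ?_, ?_, hmap, ?_, ?_⟩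
    · exact Fin.cases hr₀m fun i => (hrm i).comp measurable_finTail
    · exact Fin.cases (fun x => ENNReal.toReal_nonneg) fun i x => hr0 i _
    · exact fun x => Fin.cases (hTb _ _) fun i => hSb _ i
    · refine Fin.cases ?_ fun i => ?_
      · refine hℓ 0 (fun x => S₁ x 0) r₀ ((measurable_pi_apply 0).comp hS₁m) hr₀m
          (fun x => hTb _ _) (fun x => ?_) hderiv
        simp only [hupd]
        exact hTmono _
      · refine le_trans (le_of_eq ?_) (hrint i)
        simp only [Fin.cons_succ]
        rw [lintegral_finCons (h := fun x => p x * ENNReal.ofReal (r i (Fin.tail x)))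
          (hp.mul ((hrm i).comp measurable_finTail).ennreal_ofReal)]
        refine lintegral_congr fun a => ?_
        simp only [Fin.tail_cons]
        exact lintegral_mul_const _ (hp.comp (hcons a))
    · have hqS : ∀ᵐ a ∂(volume.withDensity fun a : Fin n → ℝ => ∫⁻ t, p (Fin.cons t a)),
          ∀ᵐ t : ℝ, q (Fin.cons t (S a)) = (∫⁻ s, q (Fin.cons s (S a))) * k (S a) t := by
        refine ae_of_ae_map (f := S) hS.aemeasurable
          (p := fun b => ∀ᵐ t : ℝ, q (Fin.cons t b) = (∫⁻ s, q (Fin.cons s b)) * k b t) ?_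
        rw [hSmap]
        exact (withDensity_absolutelyContinuous _ _).ae_le hqk
      refine ae_of_disintegrate hp hf hpf ?_ ?_
      · refine measurableSet_eq_fun hp ((hq.comp hS₁m).mul (Finset.measurable_prod _ fun i _ => ?_))
        refine Measurable.ennreal_ofReal ?_
        exact Fin.cases (motive := fun i => Measurable
          ((Fin.cons r₀ fun i x => r i (Fin.tail x) : Fin (n + 1) → (Fin (n + 1) → ℝ) → ℝ) i))
          hr₀m (fun i => (hrm i).comp measurable_finTail) i
      · filter_upwards [hrae, hqS, (withDensity_absolutelyContinuous _ _).ae_le hpf] with a h1 h2 h3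
        have h2' : ∀ᵐ t ∂(volume.withDensity (f a)), q (Fin.cons (T a t) (S a)) =
            (∫⁻ s, q (Fin.cons s (S a))) * k (S a) (T a t) := by
          refine ae_of_ae_map (f := T a) (hTa a).aemeasurable (p := fun t => q (Fin.cons t (S a)) =
            (∫⁻ s, q (Fin.cons s (S a))) * k (S a) t) ?_
          rw [hTmap]
          exact (withDensity_absolutelyContinuous _ _).ae_le h2
        have h4 : ∀ᵐ t ∂(volume.withDensity (f a)), f a t ≠ ∞ := by
          refine (withDensity_absolutelyContinuous _ _).ae_le ?_
          filter_upwards [ae_lt_top (show Measurable (f a) from hf.comp measurable_prodMk_left)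
            (by rw [hf1 a]; exact one_ne_top)] with t ht using ht.ne
        filter_upwards [h2', (withDensity_absolutelyContinuous _ _).ae_le h3, hTd a, h4]
          with t h2 h3 h5 h4
        rw [Fin.prod_univ_succ]
        simp only [Fin.cons_zero, Fin.cons_succ, hS₁cons, Fin.tail_cons, hr₀]
        rw [h3, h2, h1, ENNReal.ofReal_toReal (ENNReal.div_ne_top h4 h5.1)]
        have : k (S a) (T a t) * (f a t / k (S a) (T a t)) = f a t :=
          ENNReal.mul_div_cancel h5.1 h5.2.1
        calc _ = (∫⁻ s, q (Fin.cons s (S a))) * (∏ i, ENNReal.ofReal (r i a)) * f a t := by ring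
          _ = (∫⁻ s, q (Fin.cons s (S a))) * (∏ i, ENNReal.ofReal (r i a)) *
            (k (S a) (T a t) * (f a t / k (S a) (T a t))) := by rw [this]
          _ = _ := by ring

/-! ### Integration by parts against functions monotone in one variable -/

section Translate

variable {n : ℕ} {p D ζ : (Fin n → ℝ) → ℝ} {e : Fin n → ℝ} {R : ℝ}

lemma integral_mul_translate_sub (hD : Measurable D) (hDi : Integrable D)
    (hζ : Measurable ζ) (hζR : ∀ x, |ζ x| ≤ R) {h : ℝ} (hh : 0 ≤ h)
    (hFTC : ∀ᵐ x, p (x + h • e) - p x = ∫ s in (0 : ℝ)..h, D (x + s • e)) :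
    ∫ x, ζ x * (p (x + h • e) - p x) = ∫ s in (0 : ℝ)..h, ∫ x, ζ x * D (x + s • e) := by
  have h1 : ∫ x, ζ x * (p (x + h • e) - p x) =
      ∫ x, ∫ s in Set.Ioc 0 h, ζ x * D (x + s • e) := by
    refine integral_congr_ae ?_
    filter_upwards [hFTC] with x hx
    rw [hx, intervalIntegral.integral_of_le hh, integral_const_mul]
  rw [h1, intervalIntegral.integral_of_le hh]
  refine integral_integral_swap ?_
  have hm : Measurable fun z : (Fin n → ℝ) × ℝ => ζ z.1 * D (z.1 + z.2 • e) :=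
    (hζ.comp measurable_fst).mul
      (hD.comp (measurable_fst.add (measurable_snd.smul_const e)))
  have hb : ∀ s : ℝ, Integrable fun x => ζ x * D (x + s • e) := fun s =>
    (hDi.comp_add_right (s • e)).bdd_mul hζ.aestronglyMeasurable
      (Filter.Eventually.of_forall fun x => by simpa using hζR x)
  refine (integrable_prod_iff'
    (f := Function.uncurry fun (x : Fin n → ℝ) (s : ℝ) => ζ x * D (x + s • e))
    hm.aestronglyMeasurable).2 ⟨Filter.Eventually.of_forall hb, ?_⟩
  refine Integrable.mono' (g := fun _ => R * ∫ x, ‖D x‖) (integrable_const _) ?_ ?_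
  · exact (hm.norm.stronglyMeasurable.integral_prod_left).aestronglyMeasurable
  · refine Filter.Eventually.of_forall fun s => ?_
    rw [Real.norm_of_nonneg (integral_nonneg fun x => norm_nonneg _),
      ← integral_add_right_eq_self (fun x => ‖D x‖) (s • e), ← integral_const_mul]
    refine integral_mono (hb s).norm ((hDi.norm.comp_add_right (s • e)).const_mul R) fun x => ?_
    simp only [Function.uncurry, norm_mul]
    exact mul_le_mul_of_nonneg_right (by simpa using hζR x) (norm_nonneg _)

lemma integral_eq_zero_of_translate (hp : Integrable p) (hD : Measurable D) (hDi : Integrable D)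
    (hFTC : ∀ᵐ x, p (x + (1 : ℝ) • e) - p x = ∫ s in (0 : ℝ)..1, D (x + s • e)) :
    ∫ x, D x = 0 := by
  have h := integral_mul_translate_sub (ζ := fun _ => 1) (R := 1) hD hDi measurable_const
    (by simp) zero_le_one hFTC
  simp only [one_mul] at h
  rw [integral_sub (hp.comp_add_right _) hp, integral_add_right_eq_self] at h
  simp_rw [integral_add_right_eq_self D] at h
  simpa using h.symm

lemma tendsto_difference_quotient_integral (hp : Integrable p) (hD : Measurable D)
    (hDi : Integrable D) (hζ : Measurable ζ) (hζR : ∀ x, |ζ x| ≤ R)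
    (hFTC : ∀ h : ℝ, 0 < h → ∀ᵐ x, p (x + h • e) - p x = ∫ s in (0 : ℝ)..h, D (x + s • e))
    (hlim : ∀ᵐ x, D x ≠ 0 → Filter.Tendsto (fun s : ℝ => ζ (x + s • e))
      (nhdsWithin 0 (Set.Ioi 0)) (nhds (ζ x))) :
    Filter.Tendsto (fun m : ℕ => ∫ x, ((m : ℝ) + 1) *
      (ζ (x + (1 / ((m : ℝ) + 1)) • e) - ζ x) * p x) Filter.atTop (nhds (-∫ x, ζ x * D x)) := by
  set Φ : ℝ → ℝ := fun s => ∫ x, ζ (x + s • e) * D x with hΦ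
  have hsm : ∀ s : ℝ, Measurable fun x => ζ (x + s • e) := fun s =>
    hζ.comp (measurable_id.add_const _)
  have hΦm : StronglyMeasurable Φ := by
    have : Measurable fun z : ℝ × (Fin n → ℝ) => ζ (z.2 + z.1 • e) * D z.2 :=
      (hζ.comp (measurable_snd.add (measurable_fst.smul_const e))).mul (hD.comp measurable_snd)
    exact this.stronglyMeasurable.integral_prod_right'
  have hΦlim : Filter.Tendsto Φ (nhdsWithin 0 (Set.Ioi 0)) (nhds (∫ x, ζ x * D x)) := by
    refine tendsto_integral_filter_of_dominated_convergence (fun x => R * ‖D x‖) ?_ ?_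
      (hDi.norm.const_mul R) ?_
    · exact Filter.Eventually.of_forall fun s => ((hsm s).mul hD).aestronglyMeasurable
    · refine Filter.Eventually.of_forall fun s => Filter.Eventually.of_forall fun x => ?_
      rw [norm_mul]
      exact mul_le_mul_of_nonneg_right (by simpa using hζR _) (norm_nonneg _)
    · filter_upwards [hlim] with x hx
      by_cases h0 : D x = 0
      · simp [h0]
      · exact (hx h0).mul_const _
  have hder : HasDerivWithinAt (fun h => ∫ s in (0 : ℝ)..h, Φ s) (∫ x, ζ x * D x)
      (Set.Ici 0) 0 := by
    refine intervalIntegral.integral_hasDerivWithinAt_of_tendsto_ae_right (t := Set.Ioi 0) (by simp)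
      hΦm.stronglyMeasurableAtFilter (hΦlim.mono_left inf_le_left)
  have hlim2 : Filter.Tendsto (fun m : ℕ => ((m : ℝ) + 1) *
      ∫ s in (0 : ℝ)..(1 / ((m : ℝ) + 1)), Φ s) Filter.atTop (nhds (∫ x, ζ x * D x)) := by
    have h1 := (hasDerivWithinAt_iff_tendsto_slope.1 hder).comp
      (f := fun m : ℕ => 1 / ((m : ℝ) + 1)) (x := Filter.atTop) (by
        refine tendsto_nhdsWithin_iff.2 ⟨tendsto_one_div_add_atTop_nhds_zero_nat,
          Filter.Eventually.of_forall fun m => ?_⟩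
        have := Nat.one_div_pos_of_nat (α := ℝ) (n := m)
        exact ⟨this.le, this.ne'⟩)
    refine h1.congr fun m => ?_
    simp [slope]
  refine (hlim2.neg).congr fun m => ?_
  set h : ℝ := 1 / ((m : ℝ) + 1) with hh
  have hpos : 0 < h := Nat.one_div_pos_of_nat
  have hint : ∀ s, Integrable fun x => ζ (x + s • e) * p x := fun s =>
    hp.bdd_mul (hsm s).aestronglyMeasurable
      (Filter.Eventually.of_forall fun x => by simpa using hζR _)
  have hint' : Integrable fun x => ζ (x + h • e) * p (x + h • e) := by
    have := (hint 0).comp_add_right (h • e)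
    simpa using this
  have hA := integral_mul_translate_sub (ζ := fun x => ζ (x + h • e)) hD hDi (hsm h)
    (fun x => hζR _) hpos.le (hFTC h hpos)
  have hB : ∀ s : ℝ, ∫ x, ζ (x + h • e) * D (x + s • e) = Φ (h - s) := by
    intro s
    simp only [hΦ]
    rw [← integral_add_right_eq_self (fun x => ζ (x + (h - s) • e) * D x) (s • e)]
    refine integral_congr_ae (Filter.Eventually.of_forall fun x => ?_)
    simp only [add_assoc, ← add_smul, add_sub_cancel]
  simp_rw [hB] at hA
  rw [intervalIntegral.integral_comp_sub_left Φ h, sub_self, sub_zero] at hA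
  simp_rw [mul_assoc]
  rw [← hA, integral_const_mul, ← mul_neg]
  congr 1
  simp_rw [mul_sub, sub_mul]
  have h0 : Integrable fun x => ζ x * p x := by simpa using hint 0
  rw [integral_sub hint' (hint h), integral_sub (hint h) h0,
    integral_add_right_eq_self (fun x => ζ x * p x)]
  ring

lemma tendsto_translate_of_monotone {x : Fin n → ℝ} {r : ℝ}
    (hmono : Monotone fun s : ℝ => ζ (x + s • e))
    (h : Filter.Tendsto (fun m : ℕ => ((m : ℝ) + 1) *
      (ζ (x + (1 / ((m : ℝ) + 1)) • e) - ζ x)) Filter.atTop (nhds r)) :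
    Filter.Tendsto (fun s : ℝ => ζ (x + s • e)) (nhdsWithin 0 (Set.Ioi 0)) (nhds (ζ x)) := by
  have h1 : Filter.Tendsto (fun m : ℕ => ζ (x + (1 / ((m : ℝ) + 1)) • e)) Filter.atTop
      (nhds (ζ x)) := by
    have := (h.mul tendsto_one_div_add_atTop_nhds_zero_nat).add_const (ζ x)
    rw [mul_zero, zero_add] at this
    refine this.congr fun m => ?_
    have : (m : ℝ) + 1 ≠ 0 := by positivity
    field_simp
    ring
  refine tendsto_order.2 ⟨fun a ha => ?_, fun a ha => ?_⟩
  · filter_upwards [self_mem_nhdsWithin] with s hs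
    have := hmono (show (0 : ℝ) ≤ s from le_of_lt hs)
    simp only [zero_smul, add_zero] at this
    exact ha.trans_le this
  · obtain ⟨m, hm⟩ := ((tendsto_order.1 h1).2 a ha).exists
    filter_upwards [Ioo_mem_nhdsGT (Nat.one_div_pos_of_nat (α := ℝ) (n := m))] with s hs
    exact (hmono hs.2.le).trans_lt hm

lemma lintegral_mul_deriv_le (hp0 : ∀ x, 0 ≤ p x) (hpm : Measurable p) (hp : Integrable p)
    (hD : Measurable D) (hDi : Integrable D) (hDp : ∀ x, p x = 0 → D x = 0)
    (hζ : Measurable ζ) (hζR : ∀ x, |ζ x| ≤ R)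
    (hFTC : ∀ h : ℝ, 0 < h → ∀ᵐ x, p (x + h • e) - p x = ∫ s in (0 : ℝ)..h, D (x + s • e))
    (hmono : ∀ x, Monotone fun s : ℝ => ζ (x + s • e)) {r : (Fin n → ℝ) → ℝ}
    (hlim : ∀ᵐ x, p x ≠ 0 → Filter.Tendsto (fun m : ℕ => ((m : ℝ) + 1) *
      (ζ (x + (1 / ((m : ℝ) + 1)) • e) - ζ x)) Filter.atTop (nhds (r x))) :
    ∫⁻ x, ENNReal.ofReal (p x) * ENNReal.ofReal (r x) ≤ ENNReal.ofReal (-∫ x, ζ x * D x) := by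
  have hlim1 := tendsto_difference_quotient_integral hp hD hDi hζ hζR hFTC (by
    filter_upwards [hlim] with x hx hDx
    exact tendsto_translate_of_monotone (hmono x) (hx fun h => hDx (hDp x h)))
  have hsm : ∀ s : ℝ, Measurable fun x => ζ (x + s • e) := fun s =>
    hζ.comp (measurable_id.add_const _)
  set F : ℕ → (Fin n → ℝ) → ℝ := fun m x => ((m : ℝ) + 1) *
    (ζ (x + (1 / ((m : ℝ) + 1)) • e) - ζ x) * p x with hF
  have hFm : ∀ m, Measurable (F m) := fun m =>
    (((hsm _).sub hζ).const_mul _).mul hpm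
  have hFi : ∀ m, Integrable (F m) := fun m => by
    refine hp.bdd_mul (c := ((m : ℝ) + 1) * (R + R))
      (((hsm _).sub hζ).const_mul _).aestronglyMeasurable
      (Filter.Eventually.of_forall fun x => ?_)
    rw [Real.norm_eq_abs, abs_mul, abs_of_pos (by positivity : (0 : ℝ) < (m : ℝ) + 1)]
    refine mul_le_mul_of_nonneg_left
      ((abs_sub _ _).trans (add_le_add (hζR _) (hζR _))) (by positivity)
  have hF0 : ∀ m x, 0 ≤ F m x := fun m x => by
    have := hmono x (Nat.one_div_pos_of_nat (α := ℝ) (n := m)).le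
    simp only [zero_smul, add_zero] at this
    exact mul_nonneg (mul_nonneg (by positivity) (sub_nonneg.2 this)) (hp0 x)
  have hlim2 : Filter.Tendsto (fun m => ∫⁻ x, ENNReal.ofReal (F m x)) Filter.atTop
      (nhds (ENNReal.ofReal (-∫ x, ζ x * D x))) := by
    refine (ENNReal.tendsto_ofReal hlim1).congr fun m => ?_
    exact ofReal_integral_eq_lintegral_ofReal (hFi m) (Filter.Eventually.of_forall (hF0 m))
  rw [← hlim2.liminf_eq]
  refine le_trans (lintegral_mono_ae ?_) (lintegral_liminf_le fun m => (hFm m).ennreal_ofReal)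
  filter_upwards [hlim] with x hx
  by_cases h0 : p x = 0
  · simp [h0]
  · have h1 := ENNReal.tendsto_ofReal ((hx h0).mul_const (p x))
    rw [h1.liminf_eq, mul_comm (r x), ENNReal.ofReal_mul (hp0 x)]

end Translate

/-- If `D i` is the derivative of `p` along almost every line in the `i`-th direction, then
integration by parts bounds the mean partial derivatives of monotone functions. -/
lemma boundsMonotoneDeriv_of_translate {n : ℕ} {R : ℝ} {p : (Fin n → ℝ) → ℝ}
    {D : Fin n → (Fin n → ℝ) → ℝ} (hp0 : ∀ x, 0 ≤ p x) (hpm : Measurable p) (hp : Integrable p)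
    (hD : ∀ i, Measurable (D i)) (hDi : ∀ i, Integrable (D i)) (hDp : ∀ i x, p x = 0 → D i x = 0)
    (hFTC : ∀ i, ∀ h : ℝ, 0 < h → ∀ᵐ x, p (x + h • Pi.single i 1) - p x =
      ∫ s in (0 : ℝ)..h, D i (x + s • Pi.single i 1)) :
    BoundsMonotoneDeriv R (fun x => ENNReal.ofReal (p x)) fun i ζ => -∫ x, ζ x * D i x := by
  intro i ζ r hζ _ hζR hmono hlim
  have hupd : ∀ (x : Fin n → ℝ) (s : ℝ), Function.update x i (x i + s) = x + s • Pi.single i 1 := by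
    intro x s
    ext j
    by_cases h : j = i
    · subst h; simp
    · simp [h]
  refine lintegral_mul_deriv_le hp0 hpm hp (hD i) (hDi i) (hDp i) hζ
    (fun x => abs_le.2 (hζR x)) (hFTC i) (fun x s t hst => ?_) ?_
  · have := hmono x (add_le_add_right hst (x i))
    simpa only [hupd] using this
  · rw [ae_withDensity_iff hpm.ennreal_ofReal] at hlim
    filter_upwards [hlim] with x hx h0
    have := hx (by simpa using lt_of_le_of_ne (hp0 x) (Ne.symm h0))
    simpa only [hupd] using this

lemma ConvexOn.add_inner_gradient_le {E : Type*} [NormedAddCommGroup E] [InnerProductSpace ℝ E]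
    [CompleteSpace E] {s : Set E} {f : E → ℝ} (hf : ConvexOn ℝ s f) {x w v : E} (hx : x ∈ s)
    (hw : w ∈ s) (hv : HasGradientAt f v x) : f x + ⟪v, w - x⟫ ≤ f w := by
  have h1 : HasDerivAt (fun t : ℝ => f (x + t • (w - x))) ⟪v, w - x⟫ 0 := by
    have h2 : HasDerivAt (fun t : ℝ => x + t • (w - x)) (w - x) 0 := by
      simpa using ((hasDerivAt_id (0 : ℝ)).smul_const (w - x)).const_add x
    have h3 : HasFDerivAt f (InnerProductSpace.toDual ℝ E v) (x + (0 : ℝ) • (w - x)) := by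
      simpa using hv.hasFDerivAt
    simpa [Function.comp_def] using h3.comp_hasDerivAt (0 : ℝ) h2
  have h4 := h1.tendsto_slope_zero_right
  simp only [zero_add, zero_smul, add_zero, smul_eq_mul] at h4
  have h5 : ⟪v, w - x⟫ ≤ f w - f x := by
    refine le_of_tendsto h4 ?_
    filter_upwards [Ioo_mem_nhdsGT (zero_lt_one' ℝ)] with t ht
    have h6 := hf.2 hx hw (sub_nonneg.2 ht.2.le) ht.1.le (by ring)
    have h7 : (1 - t) • x + t • w = x + t • (w - x) := by module
    rw [h7] at h6
    simp only [smul_eq_mul] at h6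
    rw [inv_mul_le_iff₀ ht.1]
    linarith
  linarith

/-- A log-concave probability density `exp (-f - (α / 2) ‖x‖ ^ 2)` on an open convex set `O`,
together with a measurable version `g` of the gradient of the potential `f`. -/
structure GibbsDensity (d : ℕ) where
  α : ℝ
  α_pos : 0 < α
  O : Set (Ed d)
  isOpen : IsOpen O
  f : Ed d → ℝ
  convexOn : ConvexOn ℝ O f
  g : Ed d → Ed d
  measurable_g : Measurable g
  grad : ∀ᵐ x, x ∈ O → HasGradientAt f (g x) x
  mass : ∫⁻ x in O, ENNReal.ofReal (Real.exp (-f x - α / 2 * ‖x‖ ^ 2)) = 1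

lemma integrable_exp_neg_mul_sq_norm {d : ℕ} {b : ℝ} (hb : 0 < b) :
    Integrable (fun x : Ed d => Real.exp (-b * ‖x‖ ^ 2)) := by
  have h := (GaussianFourier.integrable_cexp_neg_mul_sq_norm_add (V := Ed d) (b := (b : ℂ))
    (by simpa using hb) 0 0).norm
  refine h.congr (Filter.Eventually.of_forall fun x => ?_)
  simp only [Complex.norm_exp]
  congr 1
  simp [← Complex.ofReal_pow]

namespace GibbsDensity

variable {d : ℕ} (P : GibbsDensity d)

/-- The density, extended by zero outside of `O`. -/
def p : Ed d → ℝ := P.O.indicator fun x => Real.exp (-P.f x - P.α / 2 * ‖x‖ ^ 2)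

/-- The associated probability measure. -/
def ρ : Measure (Ed d) := volume.withDensity fun x => ENNReal.ofReal (P.p x)

lemma p_of_mem {x : Ed d} (hx : x ∈ P.O) : P.p x = Real.exp (-P.f x - P.α / 2 * ‖x‖ ^ 2) :=
  Set.indicator_of_mem hx _

lemma p_of_notMem {x : Ed d} (hx : x ∉ P.O) : P.p x = 0 := Set.indicator_of_notMem hx _

lemma p_nonneg (x : Ed d) : 0 ≤ P.p x := Set.indicator_nonneg (fun _ _ => (Real.exp_pos _).le) x

lemma p_pos_iff {x : Ed d} : 0 < P.p x ↔ x ∈ P.O := by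
  by_cases h : x ∈ P.O
  · simp [P.p_of_mem h, h, Real.exp_pos]
  · simp [P.p_of_notMem h, h]

lemma continuousOn_f : ContinuousOn P.f P.O := P.convexOn.continuousOn P.isOpen

lemma measurable_p : Measurable P.p := by
  have h : ContinuousOn (fun x => Real.exp (-P.f x - P.α / 2 * ‖x‖ ^ 2)) P.O := by
    have := P.continuousOn_f
    fun_prop
  unfold p
  classical
  rw [← Set.piecewise_eq_indicator]
  exact h.measurable_piecewise continuousOn_const P.isOpen.measurableSet

lemma lintegral_p : ∫⁻ x, ENNReal.ofReal (P.p x) = 1 := by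
  rw [← P.mass, ← lintegral_indicator P.isOpen.measurableSet]
  refine lintegral_congr fun x => ?_
  by_cases h : x ∈ P.O
  · simp [P.p_of_mem h, h]
  · simp [P.p_of_notMem h, h]

lemma integrable_p : Integrable P.p := by
  refine ⟨P.measurable_p.aestronglyMeasurable, ?_⟩
  rw [hasFiniteIntegral_iff_ofReal (Filter.Eventually.of_forall P.p_nonneg), P.lintegral_p]
  exact one_lt_top

lemma integral_p : ∫ x, P.p x = 1 := by
  rw [integral_eq_lintegral_of_nonneg_ae (Filter.Eventually.of_forall P.p_nonneg)
    P.measurable_p.aestronglyMeasurable, P.lintegral_p]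
  simp

instance : IsProbabilityMeasure P.ρ := ⟨by simp [ρ, P.lintegral_p]⟩

lemma ae_ρ_iff {q : Ed d → Prop} : (∀ᵐ x ∂P.ρ, q x) ↔ ∀ᵐ x, x ∈ P.O → q x := by
  rw [ρ, ae_withDensity_iff P.measurable_p.ennreal_ofReal]
  refine Filter.eventually_congr (Filter.Eventually.of_forall fun x => ?_)
  rw [← P.p_pos_iff]
  simp

lemma ae_mem : ∀ᵐ x ∂P.ρ, x ∈ P.O := P.ae_ρ_iff.2 (Filter.Eventually.of_forall fun _ h => h)

lemma ae_grad : ∀ᵐ x ∂P.ρ, HasGradientAt P.f (P.g x) x := P.ae_ρ_iff.2 P.grad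

lemma exists_mem_grad : ∃ x ∈ P.O, HasGradientAt P.f (P.g x) x := by
  obtain ⟨x, hx⟩ := (P.ae_mem.and P.ae_grad).exists
  exact ⟨x, hx⟩

lemma integrable_ρ_iff {F : Ed d → ℝ} :
    Integrable F P.ρ ↔ Integrable fun x => P.p x * F x := by
  rw [ρ, integrable_withDensity_iff_integrable_smul' P.measurable_p.ennreal_ofReal
    (Filter.Eventually.of_forall fun _ => ofReal_lt_top)]
  refine integrable_congr (Filter.Eventually.of_forall fun x => ?_)
  simp [ENNReal.toReal_ofReal (P.p_nonneg x)]

lemma integral_ρ (F : Ed d → ℝ) : ∫ x, F x ∂P.ρ = ∫ x, P.p x * F x := by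
  rw [ρ, integral_withDensity_eq_integral_toReal_smul P.measurable_p.ennreal_ofReal
    (Filter.Eventually.of_forall fun _ => ofReal_lt_top)]
  simp [ENNReal.toReal_ofReal (P.p_nonneg _)]

lemma exists_minorant : ∃ K : ℝ, 0 ≤ K ∧ ∀ x ∈ P.O, -(K * (1 + ‖x‖)) ≤ P.f x := by
  obtain ⟨x₀, hx₀, hg⟩ := P.exists_mem_grad
  refine ⟨|P.f x₀ - ⟪P.g x₀, x₀⟫| + ‖P.g x₀‖, by positivity, fun x hx => ?_⟩
  have h := P.convexOn.add_inner_gradient_le hx₀ hx hg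
  rw [inner_sub_right] at h
  have h1 := neg_abs_le (P.f x₀ - ⟪P.g x₀, x₀⟫)
  have h2 := (abs_le.1 (abs_real_inner_le_norm (P.g x₀) x)).1
  nlinarith [abs_nonneg (P.f x₀ - ⟪P.g x₀, x₀⟫), norm_nonneg x, norm_nonneg (P.g x₀),
    mul_nonneg (abs_nonneg (P.f x₀ - ⟪P.g x₀, x₀⟫)) (norm_nonneg x)]

lemma integrable_sq_mul_p : Integrable fun x => (1 + ‖x‖ ^ 2) * P.p x := by
  obtain ⟨K, hK, hf⟩ := P.exists_minorant
  have hα := P.α_pos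
  refine Integrable.mono' ((integrable_exp_neg_mul_sq_norm (d := d)
    (by positivity : 0 < P.α / 8)).const_mul ((1 + 8 / P.α) * Real.exp (K + K ^ 2 / P.α)))
    ((by fun_prop : Measurable fun x : Ed d => 1 + ‖x‖ ^ 2).mul P.measurable_p).aestronglyMeasurable
    (Filter.Eventually.of_forall fun x => ?_)
  rw [Real.norm_of_nonneg (mul_nonneg (by positivity) (P.p_nonneg x))]
  by_cases hx : x ∈ P.O
  · rw [P.p_of_mem hx]
    have h1 : 1 + ‖x‖ ^ 2 ≤ (1 + 8 / P.α) * Real.exp (P.α / 8 * ‖x‖ ^ 2) := by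
      have h2 := Real.add_one_le_exp (P.α / 8 * ‖x‖ ^ 2)
      have h3 : 8 / P.α * (P.α / 8 * ‖x‖ ^ 2) = ‖x‖ ^ 2 := by field_simp
      have h4 : 0 < 8 / P.α := by positivity
      have h5 : 0 ≤ P.α / 8 * ‖x‖ ^ 2 := by positivity
      nlinarith
    have h6 : -P.f x - P.α / 2 * ‖x‖ ^ 2 ≤ K + K ^ 2 / P.α - P.α / 4 * ‖x‖ ^ 2 := by
      have h7 := hf x hx
      have h8 : 0 ≤ (K - P.α / 2 * ‖x‖) ^ 2 / P.α := by positivity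
      have h9 : (K - P.α / 2 * ‖x‖) ^ 2 / P.α = K ^ 2 / P.α - K * ‖x‖ + P.α / 4 * ‖x‖ ^ 2 := by
        field_simp; ring
      linarith
    calc (1 + ‖x‖ ^ 2) * Real.exp (-P.f x - P.α / 2 * ‖x‖ ^ 2)
        ≤ ((1 + 8 / P.α) * Real.exp (P.α / 8 * ‖x‖ ^ 2)) *
          Real.exp (K + K ^ 2 / P.α - P.α / 4 * ‖x‖ ^ 2) := by gcongr
      _ = _ := by
        rw [mul_assoc, mul_assoc, ← Real.exp_add, ← Real.exp_add]
        congr 2; ring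
  · rw [P.p_of_notMem hx]; simp only [mul_zero]; positivity

lemma integrable_sq : Integrable (fun x => ‖x‖ ^ 2) P.ρ := by
  rw [integrable_ρ_iff]
  exact P.integrable_sq_mul_p.mono' (P.measurable_p.mul (by fun_prop)).aestronglyMeasurable
    (Filter.Eventually.of_forall fun x => by
      have := P.p_nonneg x
      rw [Real.norm_of_nonneg (by positivity)]; nlinarith)

lemma integrable_norm : Integrable (fun x => ‖x‖) P.ρ := by
  refine (P.integrable_sq.add (integrable_const 1)).mono' (by fun_prop)
    (Filter.Eventually.of_forall fun x => ?_)
  simp only [norm_norm, Pi.add_apply]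
  nlinarith [sq_nonneg (‖x‖ - 1)]

lemma integrable_of_norm_le {F : Ed d → ℝ} (hF : AEStronglyMeasurable F P.ρ) {C : ℝ}
    (h : ∀ x, ‖F x‖ ≤ C * (1 + ‖x‖)) : Integrable F P.ρ :=
  (((integrable_const 1).add P.integrable_norm).const_mul C).mono' hF
    (Filter.Eventually.of_forall h)

lemma measurable_indicator_f : Measurable (P.O.indicator P.f) := by
  classical
  rw [← Set.piecewise_eq_indicator]
  exact P.continuousOn_f.measurable_piecewise continuousOn_const P.isOpen.measurableSet

lemma integrable_f : Integrable P.f P.ρ := by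
  obtain ⟨K, hK, hf⟩ := P.exists_minorant
  have h0 : Integrable (fun x => 2 * (K * (1 + ‖x‖))) P.ρ :=
    (((integrable_const 1).add P.integrable_norm).const_mul K).const_mul 2
  refine integrable_ρ_iff _ |>.2 (((integrable_exp_neg_mul_sq_norm (d := d)
    (half_pos P.α_pos)).add (P.integrable_ρ_iff.1 h0)).mono' ?_
    (Filter.Eventually.of_forall fun x => ?_))
  · refine (P.measurable_p.mul P.measurable_indicator_f).aestronglyMeasurable.congr
      (Filter.Eventually.of_forall fun x => ?_)
    by_cases hx : x ∈ P.O
    · simp [hx]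
    · simp [P.p_of_notMem hx]
  by_cases hx : x ∈ P.O
  · have h1 := hf x hx
    have h2 : |P.f x| ≤ P.f x + 2 * (K * (1 + ‖x‖)) := abs_le.2 ⟨by linarith, by
      have : 0 ≤ K * (1 + ‖x‖) := by positivity
      linarith⟩
    have h3 : P.p x * P.f x ≤ Real.exp (-(P.α / 2) * ‖x‖ ^ 2) := by
      rw [P.p_of_mem hx, sub_eq_add_neg, Real.exp_add, ← neg_mul]
      have h4 : Real.exp (-P.f x) * P.f x ≤ 1 := by
        rw [Real.exp_neg, inv_mul_le_iff₀ (Real.exp_pos _), mul_one]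
        linarith [Real.add_one_le_exp (P.f x)]
      nlinarith [Real.exp_pos (-(P.α / 2) * ‖x‖ ^ 2)]
    rw [norm_mul, Real.norm_of_nonneg (P.p_nonneg x), Real.norm_eq_abs]
    have := mul_le_mul_of_nonneg_left h2 (P.p_nonneg x)
    simp only [Pi.add_apply]
    linarith
  · simp only [P.p_of_notMem hx, zero_mul, norm_zero, Pi.add_apply, add_zero]
    positivity

end GibbsDensity

namespace GibbsDensity

variable {d : ℕ} (P : GibbsDensity d)

/-- The full potential of the density. -/
def V (x : Ed d) : ℝ := P.f x + P.α / 2 * ‖x‖ ^ 2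

lemma p_eq_exp_neg_V {x : Ed d} (hx : x ∈ P.O) : P.p x = Real.exp (-P.V x) := by
  rw [P.p_of_mem hx, V]; congr 1; ring

lemma convexOn_V : ConvexOn ℝ P.O P.V := by
  have h : ConvexOn ℝ P.O fun x : Ed d => ‖x‖ ^ 2 :=
    (convexOn_norm P.convexOn.1).pow (fun _ _ => norm_nonneg _) 2
  exact P.convexOn.add (h.smul (half_pos P.α_pos).le)

lemma hasGradientAt_V {x : Ed d} (hx : HasGradientAt P.f (P.g x) x) :
    HasGradientAt P.V (P.g x + P.α • x) x := by
  rw [hasGradientAt_iff_hasFDerivAt] at hx ⊢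
  have h := hx.add (((hasStrictFDerivAt_norm_sq x).hasFDerivAt).const_mul (P.α / 2))
  have h1 : InnerProductSpace.toDual ℝ (Ed d) (P.g x + P.α • x) =
      InnerProductSpace.toDual ℝ (Ed d) (P.g x) + (P.α / 2) • (2 : ℕ) • innerSL ℝ x := by
    rw [← Nat.cast_smul_eq_nsmul ℝ]
    ext v
    simp only [InnerProductSpace.toDual_apply_apply, inner_add_left, real_inner_smul_left,
      add_apply, FunLike.coe_smul, Pi.smul_apply,
      innerSL_apply_apply, smul_eq_mul, Nat.cast_ofNat]
    ring
  rw [h1]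
  exact h

lemma integrable_V : Integrable P.V P.ρ :=
  P.integrable_f.add (P.integrable_sq.const_mul _)

lemma hasDerivAt_p_lineMap {x : Ed d} (hx : x ∈ P.O) (hg : HasGradientAt P.f (P.g x) x)
    (e : Ed d) :
    HasDerivAt (fun t : ℝ => P.p (x + t • e)) (-(⟪P.g x + P.α • x, e⟫ * P.p x)) 0 := by
  have h2 : HasDerivAt (fun t : ℝ => x + t • e) e 0 := by
    simpa using ((hasDerivAt_id (0 : ℝ)).smul_const e).const_add x
  have h3 : HasFDerivAt P.V (InnerProductSpace.toDual ℝ _ (P.g x + P.α • x))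
      (x + (0 : ℝ) • e) := by
    simpa using (P.hasGradientAt_V hg).hasFDerivAt
  have h4 := ((h3.comp_hasDerivAt (0 : ℝ) h2).neg).exp
  have h5 : (fun t : ℝ => P.p (x + t • e)) =ᶠ[nhds 0] fun t => Real.exp (-P.V (x + t • e)) := by
    have h6 : ∀ᶠ t : ℝ in nhds 0, x + t • e ∈ P.O := by
      refine h2.continuousAt (P.isOpen.mem_nhds ?_)
      simpa using hx
    filter_upwards [h6] with t ht using P.p_eq_exp_neg_V ht
  refine HasDerivAt.congr_of_eventuallyEq ?_ h5
  have h6 : -(⟪P.g x + P.α • x, e⟫ * P.p x) = Real.exp ((-P.V ∘ fun t : ℝ => x + t • e) 0) *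
      -((InnerProductSpace.toDual ℝ (Ed d)) (P.g x + P.α • x)) e := by
    simp [P.p_eq_exp_neg_V hx, inner_add_left, real_inner_smul_left]
    ring
  rw [h6]
  exact h4

lemma integral_p_homothety (w : Ed d) {c : ℝ} (hc : 0 < c) :
    ∫ z, P.p (w + c • (z - w)) = (c ^ d)⁻¹ := by
  have h1 := integral_sub_right_eq_self (μ := (volume : Measure (Ed d)))
    (fun y => P.p (w + c • y)) w
  rw [h1, Measure.integral_comp_smul volume (fun y => P.p (w + y)) c,
    integral_add_left_eq_self (μ := (volume : Measure (Ed d))) P.p w, P.integral_p]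
  simp [abs_of_pos hc]

lemma integrable_p_homothety (w : Ed d) {c : ℝ} (hc : 0 < c) :
    Integrable fun z => P.p (w + c • (z - w)) := by
  have h1 : Integrable fun y => P.p (w + c • y) :=
    (P.integrable_p.comp_add_left w).comp_smul hc.ne'
  exact h1.comp_sub_right w

lemma mul_V_sub_le (w : Ed d) (hw : w ∈ P.O) {ε : ℝ} (h0 : 0 < ε) (h1 : ε < 1) (z : Ed d) :
    P.p z * (P.V z - P.V w) ≤ ε⁻¹ * (P.p (w + (1 - ε) • (z - w)) - P.p z) := by
  by_cases hz : z ∈ P.O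
  · have h2 : w + (1 - ε) • (z - w) = (1 - ε) • z + ε • w := by module
    have h3 : (1 - ε) • z + ε • w ∈ P.O :=
      P.convexOn.1 hz hw (sub_nonneg.2 h1.le) h0.le (by ring)
    have h4 := P.convexOn_V.2 hz hw (sub_nonneg.2 h1.le) h0.le (by ring)
    rw [h2, le_inv_mul_iff₀ h0, P.p_eq_exp_neg_V hz, P.p_eq_exp_neg_V h3]
    simp only [smul_eq_mul] at h4
    have h5 : Real.exp (-P.V z) * Real.exp (ε * (P.V z - P.V w)) ≤
        Real.exp (-P.V ((1 - ε) • z + ε • w)) := by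
      rw [← Real.exp_add, Real.exp_le_exp]
      linarith
    have h6 := Real.add_one_le_exp (ε * (P.V z - P.V w))
    nlinarith [Real.exp_pos (-P.V z)]
  · rw [P.p_of_notMem hz, zero_mul, sub_zero]
    exact mul_nonneg (inv_nonneg.2 h0.le) (P.p_nonneg _)

lemma tendsto_inv_pow_slope (d : ℕ) :
    Filter.Tendsto (fun ε : ℝ => ε⁻¹ * (((1 - ε) ^ d)⁻¹ - 1)) (nhdsWithin 0 (Set.Ioi 0))
      (nhds d) := by
  have h1 : HasDerivAt (fun ε : ℝ => ((1 - ε) ^ d)⁻¹) d 0 := by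
    have h2 : HasDerivAt (fun ε : ℝ => 1 - ε) (-1) 0 := (hasDerivAt_id (0 : ℝ)).const_sub 1
    have h3 := (h2.pow d).inv (by simp)
    have h4 : (d : ℝ) =
        -(d * (1 - (0 : ℝ)) ^ (d - 1) * -1) / (((fun ε : ℝ => 1 - ε) ^ d) 0) ^ 2 := by
      simp
    rw [h4]
    exact h3
  simpa using h1.tendsto_slope_zero_right

lemma integrable_and_integral_inner_sub_le {w : Ed d} (hw : w ∈ P.O) :
    Integrable (fun z => ⟪P.g z + P.α • z, z - w⟫) P.ρ ∧
      ∫ z, ⟪P.g z + P.α • z, z - w⟫ ∂P.ρ ≤ d := by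
  have hVi : Integrable (fun z => P.p z * (P.V z - P.V w)) :=
    P.integrable_ρ_iff.1 (P.integrable_V.sub (integrable_const _))
  set ψ : Ed d → ℝ := fun z => ⟪P.g z + P.α • z, z - w⟫ with hψ
  have hψm : Measurable ψ := by
    have := P.measurable_g
    fun_prop
  set ε : ℕ → ℝ := fun m => 1 / ((m : ℝ) + 2) with hε
  have hε0 : ∀ m, 0 < ε m := fun m => by positivity
  have hε1 : ∀ m, ε m < 1 := fun m => by
    rw [hε, div_lt_one (by positivity)]; have := m.cast_nonneg (α := ℝ); linarith
  have hεt : Filter.Tendsto ε Filter.atTop (nhdsWithin 0 (Set.Ioi 0)) := by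
    refine tendsto_nhdsWithin_iff.2 ⟨?_, Filter.Eventually.of_forall hε0⟩
    have := (tendsto_one_div_add_atTop_nhds_zero_nat (𝕜 := ℝ)).comp (Filter.tendsto_add_atTop_nat 1)
    refine this.congr fun m => ?_
    simp only [Function.comp, hε]; push_cast; ring
  set G : ℕ → Ed d → ℝ := fun m z =>
    (ε m)⁻¹ * (P.p (w + (1 - ε m) • (z - w)) - P.p z) - P.p z * (P.V z - P.V w) with hG
  set H : Ed d → ℝ := fun z => P.p z * ψ z - P.p z * (P.V z - P.V w) with hH
  have hG0 : ∀ m z, 0 ≤ G m z := fun m z =>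
    sub_nonneg.2 (P.mul_V_sub_le w hw (hε0 m) (hε1 m) z)
  have hGi : ∀ m, Integrable (G m) := fun m =>
    (((P.integrable_p_homothety w (sub_pos.2 (hε1 m))).sub P.integrable_p).const_mul _).sub hVi
  have hGint : ∀ m, ∫ z, G m z = (ε m)⁻¹ * (((1 - ε m) ^ d)⁻¹ - 1) -
      ∫ z, P.p z * (P.V z - P.V w) := fun m => by
    have hi : Integrable fun z => (ε m)⁻¹ * (P.p (w + (1 - ε m) • (z - w)) - P.p z) :=
      ((P.integrable_p_homothety w (sub_pos.2 (hε1 m))).sub P.integrable_p).const_mul _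
    rw [hG, integral_sub hi hVi, integral_const_mul,
      integral_sub (P.integrable_p_homothety w (sub_pos.2 (hε1 m))) P.integrable_p,
      P.integral_p_homothety w (sub_pos.2 (hε1 m)), P.integral_p]
  have hGlim : ∀ᵐ z, Filter.Tendsto (fun m => G m z) Filter.atTop (nhds (H z)) ∨ H z = 0 := by
    filter_upwards [P.grad] with z hz
    by_cases hzO : z ∈ P.O
    · left
      have h1 := (P.hasDerivAt_p_lineMap hzO (hz hzO) (w - z)).tendsto_slope_zero_right.comp hεt
      refine Filter.Tendsto.sub_const ?_ _
      have h2 : P.p z * ψ z = -(⟪P.g z + P.α • z, w - z⟫ * P.p z) := by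
        rw [hψ, ← neg_sub z w, inner_neg_right]; ring
      rw [h2]
      refine h1.congr fun m => ?_
      simp only [Function.comp, zero_add, zero_smul, add_zero, smul_eq_mul]
      congr 3
      module
    · right; simp [hH, P.p_of_notMem hzO]
  have hH0 : ∀ᵐ z, 0 ≤ H z := by
    filter_upwards [hGlim] with z hz
    rcases hz with hz | hz
    · exact ge_of_tendsto' hz fun m => hG0 m z
    · exact hz.ge
  have hlim := (((tendsto_inv_pow_slope d).comp hεt).sub_const (∫ z, P.p z * (P.V z - P.V w)))
  have hfatou : ∫⁻ z, ENNReal.ofReal (H z) ≤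
      ENNReal.ofReal (d - ∫ z, P.p z * (P.V z - P.V w)) := by
    calc ∫⁻ z, ENNReal.ofReal (H z)
        ≤ ∫⁻ z, Filter.liminf (fun m => ENNReal.ofReal (G m z)) Filter.atTop := by
          refine lintegral_mono_ae ?_
          filter_upwards [hGlim] with z hz
          rcases hz with hz | hz
          · exact ((ENNReal.continuous_ofReal.tendsto _).comp hz).liminf_eq.ge
          · simp [hz]
      _ ≤ Filter.liminf (fun m => ∫⁻ z, ENNReal.ofReal (G m z)) Filter.atTop :=
          lintegral_liminf_le' fun m => (hGi m).1.aemeasurable.ennreal_ofReal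
      _ = _ := by
          refine Filter.Tendsto.liminf_eq ?_
          refine ((ENNReal.continuous_ofReal.tendsto _).comp hlim).congr fun m => ?_
          rw [← ofReal_integral_eq_lintegral_ofReal (hGi m) (Filter.Eventually.of_forall (hG0 m)),
            hGint]
          rfl
  have hHi : Integrable H := by
    refine ⟨((P.measurable_p.mul hψm).aestronglyMeasurable.sub hVi.1), ?_⟩
    rw [hasFiniteIntegral_iff_ofReal hH0]
    exact hfatou.trans_lt ofReal_lt_top
  have hHle : ∫ z, H z ≤ d - ∫ z, P.p z * (P.V z - P.V w) := by
    have h0 : 0 ≤ (d : ℝ) - ∫ z, P.p z * (P.V z - P.V w) :=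
      ge_of_tendsto' hlim fun m => by
        have := integral_nonneg (μ := volume) (f := G m) (hG0 m)
        rw [hGint] at this
        exact this
    rw [integral_eq_lintegral_of_nonneg_ae hH0 hHi.1]
    exact ENNReal.toReal_le_of_le_ofReal h0 hfatou
  have hpi : Integrable fun z => P.p z * ψ z := by
    refine (hHi.add hVi).congr (Filter.Eventually.of_forall fun z => ?_)
    simp [hH]
  refine ⟨P.integrable_ρ_iff.2 hpi, ?_⟩
  rw [integral_ρ]
  have := integral_sub hpi hVi
  change ∫ z, H z = _ at this
  linarith

lemma integrable_inner_sub {w : Ed d} (hw : w ∈ P.O) :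
    Integrable (fun z => ⟪P.g z, z - w⟫) P.ρ := by
  have h1 : Integrable (fun z : Ed d => P.α * (‖z‖ ^ 2 - ⟪z, w⟫)) P.ρ := by
    refine (P.integrable_sq.sub ?_).const_mul _
    refine P.integrable_of_norm_le (C := ‖w‖) (by fun_prop) fun z => ?_
    have := norm_inner_le_norm (𝕜 := ℝ) z w
    nlinarith [norm_nonneg z, norm_nonneg w]
  refine ((P.integrable_and_integral_inner_sub_le hw).1.sub h1).congr
    (Filter.Eventually.of_forall fun z => ?_)
  simp only [Pi.sub_apply, inner_add_left, inner_sub_right, real_inner_smul_left,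
    real_inner_self_eq_norm_sq]
  ring

lemma integrable_g : Integrable P.g P.ρ := by
  obtain ⟨w, hw, -⟩ := P.exists_mem_grad
  obtain ⟨r, hr, hball⟩ := Metric.nhds_basis_closedBall.mem_iff.1 (P.isOpen.mem_nhds hw)
  obtain ⟨M, hM⟩ := (isCompact_closedBall w r).bddAbove_image (P.continuousOn_f.mono hball)
  have h1 : Integrable (fun z => r⁻¹ * (M - P.f z + ⟪P.g z, z - w⟫)) P.ρ :=
    (((integrable_const M).sub P.integrable_f).add (P.integrable_inner_sub hw)).const_mul _
  refine h1.mono' P.measurable_g.aestronglyMeasurable ?_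
  filter_upwards [P.ae_mem, P.ae_grad] with z hz hg
  rw [le_inv_mul_iff₀ hr]
  set v : Ed d := w + (r / ‖P.g z‖) • P.g z with hv
  have hvb : v ∈ Metric.closedBall w r := by
    rw [mem_closedBall_iff_norm, hv, add_sub_cancel_left, norm_smul,
      Real.norm_of_nonneg (by positivity)]
    by_cases h0 : ‖P.g z‖ = 0
    · simp [h0, hr.le]
    · rw [div_mul_cancel₀ _ h0]
  have h2 := P.convexOn.add_inner_gradient_le hz (hball hvb) hg
  have h3 : P.f v ≤ M := hM ⟨v, hvb, rfl⟩
  have h4 : ⟪P.g z, v - z⟫ = r * ‖P.g z‖ - ⟪P.g z, z - w⟫ := by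
    have h5 : v - z = (r / ‖P.g z‖) • P.g z - (z - w) := by rw [hv]; module
    rw [h5, inner_sub_right, real_inner_smul_right, real_inner_self_eq_norm_sq]
    by_cases h0 : ‖P.g z‖ = 0
    · simp [h0]
    · field_simp
  linarith

lemma integrable_inner_g (v : Ed d) : Integrable (fun z => ⟪P.g z, v⟫) P.ρ :=
  P.integrable_g.inner_const v

lemma integrable_inner : Integrable (fun z => ⟪P.g z, z⟫) P.ρ := by
  obtain ⟨w, hw, -⟩ := P.exists_mem_grad
  refine ((P.integrable_inner_sub hw).add (P.integrable_inner_g w)).congr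
    (Filter.Eventually.of_forall fun z => ?_)
  simp [inner_sub_right]

lemma integral_inner_le (h0 : ∀ v : Ed d, ∫ z, ⟪P.g z + P.α • z, v⟫ ∂P.ρ = 0) :
    ∫ z, ⟪P.g z, z⟫ ∂P.ρ + P.α * ∫ z, ‖z‖ ^ 2 ∂P.ρ ≤ d := by
  obtain ⟨w, hw, -⟩ := P.exists_mem_grad
  have h1 := (P.integrable_and_integral_inner_sub_le hw)
  have h3 : Integrable (fun z => ⟪P.g z, z⟫ + P.α * ‖z‖ ^ 2) P.ρ :=
    P.integrable_inner.add (P.integrable_sq.const_mul _)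
  have h2 : ∀ z, ⟪P.g z + P.α • z, w⟫ =
      (⟪P.g z, z⟫ + P.α * ‖z‖ ^ 2) - ⟪P.g z + P.α • z, z - w⟫ := fun z => by
    rw [inner_sub_right (P.g z + P.α • z), inner_add_left _ _ z, real_inner_smul_left z,
      real_inner_self_eq_norm_sq]
    ring
  have h4 := h0 w
  simp_rw [h2] at h4
  rw [integral_sub h3 h1.1, integral_add P.integrable_inner (P.integrable_sq.const_mul _),
    integral_const_mul] at h4
  linarith [h1.2]

end GibbsDensity

lemma Convex.countable_frontier {I : Set ℝ} (hI : Convex ℝ I) (hIo : IsOpen I) :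
    (frontier I).Countable := by
  refine (Set.toFinite {sSup I, sInf I}).countable.mono fun x hx => ?_
  have hxc : x ∈ closure I := frontier_subset_closure hx
  have hxI : x ∉ I := by
    rw [hIo.frontier_eq] at hx; exact hx.2
  by_cases h : ∀ y ∈ I, y ≤ x
  · left
    have hl := isLUB_of_mem_closure h hxc
    exact (hl.csSup_eq (closure_nonempty_iff.1 ⟨x, hxc⟩)).symm
  · right
    push Not at h
    obtain ⟨z, hz, hxz⟩ := h
    have hl : IsGLB I x := isGLB_of_mem_closure (fun y hy => by
      by_contra! hyx
      exact hxI (hI.ordConnected.out hy hz ⟨hyx.le, hxz.le⟩)) hxc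
    exact (hl.csInf_eq ⟨z, hz⟩).symm

lemma sub_eq_integral_of_eqOn_exp_neg {I : Set ℝ} {W φ D : ℝ → ℝ} {h : ℝ} (hh : 0 < h)
    (hIo : IsOpen I) (hW : ConvexOn ℝ I W) (hφI : ∀ t ∈ I, φ t = Real.exp (-W t))
    (hφI' : ∀ t ∉ I, φ t = 0) (hφ : Continuous φ) (hD : IntegrableOn D (Set.Icc 0 h))
    (hderiv : ∀ᵐ t, t ∈ I → HasDerivAt φ (D t) t) (hD0 : ∀ t ∉ I, D t = 0) :
    φ h - φ 0 = ∫ t in (0 : ℝ)..h, D t := by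
  have hDi : IntervalIntegrable D volume 0 h :=
    (intervalIntegrable_iff_integrableOn_Icc_of_le hh.le).2 hD
  set H : ℝ → ℝ := fun t => φ t - ∫ s in (0 : ℝ)..t, D s with hH
  have hHc : ContinuousOn H (Set.uIcc 0 h) := by
    refine hφ.continuousOn.sub (intervalIntegral.continuousOn_primitive_interval ?_)
    rwa [Set.uIcc_of_le hh.le]
  have hlocal : ∀ t₀ ∈ Set.Ioo 0 h \ frontier I, ∃ ε > 0, ∀ t ∈ Set.Ioo (t₀ - ε) (t₀ + ε),
      φ t - φ t₀ = ∫ s in t₀..t, D s := by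
    intro t₀ ht₀
    by_cases htI : t₀ ∈ I
    · obtain ⟨K, s, hs, hKs⟩ := hW.locallyLipschitzOn hIo htI
      rw [hIo.nhdsWithin_eq htI] at hs
      obtain ⟨K', s', hs', hKs'⟩ :=
        (Real.contDiff_exp.contDiffAt (x := -W t₀)).exists_lipschitzOnWith
      have hWc : ContinuousAt W t₀ := (hW.continuousOn hIo).continuousAt (hIo.mem_nhds htI)
      obtain ⟨ε, hε, hball⟩ := Metric.mem_nhds_iff.1 (Filter.inter_mem (Filter.inter_mem hs
        (hIo.mem_nhds htI)) (hWc.neg.preimage_mem_nhds hs'))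
      refine ⟨ε, hε, fun t ht => ?_⟩
      rw [Real.ball_eq_Ioo] at hball
      have hsub : Set.uIcc t₀ t ⊆ Set.Ioo (t₀ - ε) (t₀ + ε) :=
        Set.ordConnected_Ioo.uIcc_subset ⟨by linarith, by linarith⟩ ht
      have hlip : LipschitzOnWith (K' * K) φ (Set.uIcc t₀ t) := by
        have h1 : LipschitzOnWith K (fun t => -W t) (Set.uIcc t₀ t) :=
          (hKs.mono fun y hy => (hball (hsub hy)).1.1).neg
        have h2 := hKs'.comp h1 fun y hy => (hball (hsub hy)).2
        intro y hy z hz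
        rw [hφI y (hball (hsub hy)).1.2, hφI z (hball (hsub hz)).1.2]
        exact h2 hy hz
      rw [← hlip.absolutelyContinuousOnInterval.integral_deriv_eq_sub]
      refine intervalIntegral.integral_congr_ae ?_
      filter_upwards [hderiv] with y hy hyt
      exact (hy (hball (hsub (Set.uIoc_subset_uIcc hyt))).1.2).deriv
    · have hint : t₀ ∈ interior Iᶜ := by
        rw [interior_compl, Set.mem_compl_iff]
        intro hc
        exact ht₀.2 (hIo.frontier_eq ▸ ⟨hc, htI⟩)
      obtain ⟨ε, hε, hball⟩ := Metric.mem_nhds_iff.1 (mem_interior_iff_mem_nhds.1 hint)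
      refine ⟨ε, hε, fun t ht => ?_⟩
      rw [Real.ball_eq_Ioo] at hball
      have hsub : Set.uIcc t₀ t ⊆ Set.Ioo (t₀ - ε) (t₀ + ε) :=
        Set.ordConnected_Ioo.uIcc_subset ⟨by linarith, by linarith⟩ ht
      rw [hφI' t (hball ht), hφI' t₀ htI, sub_self]
      refine (intervalIntegral.integral_zero_ae (Filter.Eventually.of_forall fun y hy => ?_)).symm
      exact hD0 y (hball (hsub (Set.uIoc_subset_uIcc hy)))
  have hHd : ∀ t ∈ Set.Ioo (min 0 h) (max 0 h) \ frontier I, HasDerivAt H 0 t := by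
    rw [min_eq_left hh.le, max_eq_right hh.le]
    intro t₀ ht₀
    obtain ⟨ε, hε, hloc⟩ := hlocal t₀ ht₀
    refine (hasDerivAt_const t₀ (H t₀)).congr_of_eventuallyEq ?_
    filter_upwards [Ioo_mem_nhds (sub_lt_self t₀ hε) (lt_add_of_pos_right t₀ hε),
      Ioo_mem_nhds ht₀.1.1 ht₀.1.2] with t ht ht'
    have h1 : IntervalIntegrable D volume 0 t := hDi.mono_set (by
      rw [Set.uIcc_of_le hh.le, Set.uIcc_of_le ht'.1.le]
      exact Set.Icc_subset_Icc_right ht'.2.le)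
    have h2 : IntervalIntegrable D volume 0 t₀ := hDi.mono_set (by
      rw [Set.uIcc_of_le hh.le, Set.uIcc_of_le ht₀.1.1.le]
      exact Set.Icc_subset_Icc_right ht₀.1.2.le)
    have h3 := intervalIntegral.integral_interval_sub_left h1 h2
    have h4 := hloc t ht
    simp only [hH]
    linarith
  have hfin := MeasureTheory.integral_eq_of_hasDerivAt_off_countable H (fun _ => 0)
    (hW.1.countable_frontier hIo) hHc hHd (by simp)
  simp only [hH, intervalIntegral.integral_zero, intervalIntegral.integral_same] at hfin
  linarith

lemma ae_line_notMem_of_hausdorffMeasure_eq_zero {m : ℕ} (i : Fin (m + 1)) {N : Set (Ed (m + 1))}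
    (hN : μH[(m : ℝ)] N = 0) :
    ∀ᵐ x : Fin (m + 1) → ℝ, ∀ t : ℝ, WithLp.toLp 2 (x + t • Pi.single i 1) ∉ N := by
  set π : Ed (m + 1) → (Fin m → ℝ) := fun x => i.removeNth (WithLp.ofLp x) with hπ
  have hlip : LipschitzWith 1 π := by
    refine LipschitzWith.of_dist_le_mul fun x y => ?_
    rw [NNReal.coe_one, one_mul]
    refine (dist_pi_le_iff dist_nonneg).2 fun j => ?_
    rw [dist_eq_norm, dist_eq_norm]
    exact PiLp.norm_apply_le (x - y) (i.succAbove j)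
  have h1 : volume (π '' N) = 0 := by
    have h2 := hlip.hausdorffMeasure_image_le (Nat.cast_nonneg m) N
    rw [hN, mul_zero, nonpos_iff_eq_zero] at h2
    have h3 := hausdorffMeasure_pi_real (ι := Fin m)
    rw [Fintype.card_fin] at h3
    rwa [h3] at h2
  have h4 : ∀ᵐ y : Fin m → ℝ, y ∉ π '' N := measure_eq_zero_iff_ae_notMem.1 h1
  have h5 : ∀ᵐ z : ℝ × (Fin m → ℝ), z.2 ∉ π '' N := Measure.quasiMeasurePreserving_snd.ae h4
  filter_upwards [(volume_preserving_piFinSuccAbove (fun _ : Fin (m + 1) => ℝ)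
    i).quasiMeasurePreserving.ae h5] with x hx t ht
  refine hx ⟨_, ht, ?_⟩
  ext j
  simp [hπ, Fin.removeNth]

lemma ae_ae_add_smul {E : Type*} [NormedAddCommGroup E] [NormedSpace ℝ E] [FiniteDimensional ℝ E]
    [MeasureSpace E] [BorelSpace E] [(volume : Measure E).IsAddHaarMeasure] {q : E → Prop}
    (h : ∀ᵐ x, q x) (e : E) : ∀ᵐ x, ∀ᵐ s : ℝ, q (x + s • e) := by
  obtain ⟨A, hsub, hA, hA0⟩ := exists_measurable_superset_of_null (ae_iff.1 h)
  have h1 : ∀ᵐ x, x ∉ A := measure_eq_zero_iff_ae_notMem.1 hA0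
  have h2 : MeasurableSet {x : E × ℝ | x.1 + x.2 • e ∉ A} :=
    hA.compl.preimage (f := fun x : E × ℝ => x.1 + x.2 • e) (by fun_prop)
  have h3 := (Measure.ae_ae_comm (μ := (volume : Measure E)) (ν := (volume : Measure ℝ)) h2).2
    (Filter.Eventually.of_forall fun s =>
      (measurePreserving_add_right volume (s • e)).quasiMeasurePreserving.ae h1)
  filter_upwards [h3] with x hx
  filter_upwards [hx] with s hs
  by_contra hq
  exact hs (hsub hq)

lemma ae_integrableOn_add_smul {E : Type*} [NormedAddCommGroup E] [NormedSpace ℝ E]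
    [FiniteDimensional ℝ E] [MeasureSpace E] [BorelSpace E]
    [(volume : Measure E).IsAddHaarMeasure] {D : E → ℝ} (hD : Measurable D) (hDi : Integrable D)
    (e : E) (h : ℝ) : ∀ᵐ x, IntegrableOn (fun s : ℝ => D (x + s • e)) (Set.Icc 0 h) := by
  have hm : Measurable fun z : E × ℝ => D (z.1 + z.2 • e) := hD.comp (by fun_prop)
  have h1 : Integrable (fun z : E × ℝ => D (z.1 + z.2 • e))
      ((volume : Measure E).prod (volume.restrict (Set.Icc 0 h))) := by
    rw [integrable_prod_iff' hm.aestronglyMeasurable]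
    refine ⟨Filter.Eventually.of_forall fun s => hDi.comp_add_right (s • e), ?_⟩
    simp_rw [integral_add_right_eq_self fun x => ‖D x‖]
    exact integrable_const _
  exact h1.prod_right_ae

namespace GibbsDensity

variable {d : ℕ} (P : GibbsDensity d)

lemma convexOn_line (z e : Ed d) :
    ConvexOn ℝ {t : ℝ | z + t • e ∈ P.O} fun t => P.V (z + t • e) := by
  have h := P.convexOn_V.comp_affineMap (AffineMap.lineMap (k := ℝ) z (z + e))
  have h1 : ∀ t : ℝ, AffineMap.lineMap z (z + e) t = z + t • e := fun t => by
    rw [AffineMap.lineMap_apply_module']; module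
  simpa only [Set.preimage, h1, Function.comp_def] using h

lemma continuousAt_p {z : Ed d} (hz : z ∈ frontier P.O → ContinuousAt P.p z) :
    ContinuousAt P.p z := by
  by_cases hf : z ∈ frontier P.O
  · exact hz hf
  by_cases hO : z ∈ P.O
  · have h1 : ContinuousAt (fun x => Real.exp (-P.V x)) z :=
      ((P.convexOn_V.continuousOn P.isOpen).continuousAt (P.isOpen.mem_nhds hO)).neg.rexp
    refine h1.congr ?_
    filter_upwards [P.isOpen.mem_nhds hO] with x hx using (P.p_eq_exp_neg_V hx).symm
  · have hc : z ∉ closure P.O := fun hc => hf (P.isOpen.frontier_eq ▸ ⟨hc, hO⟩)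
    refine (continuousAt_const (y := (0 : ℝ))).congr ?_
    filter_upwards [isClosed_closure.isOpen_compl.mem_nhds hc] with x hx
    exact (P.p_of_notMem fun h => hx (subset_closure h)).symm

/-- The derivative of the density in the direction `e`. -/
def D (e z : Ed d) : ℝ := -(⟪P.g z + P.α • z, e⟫ * P.p z)

lemma measurable_D (e : Ed d) : Measurable (P.D e) := by
  have := P.measurable_g
  have := P.measurable_p
  unfold D
  fun_prop

lemma integrable_inner_grad (e : Ed d) : Integrable (fun z => ⟪P.g z + P.α • z, e⟫) P.ρ := by
  have h : Integrable (fun z : Ed d => z) P.ρ :=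
    P.integrable_norm.mono' (by fun_prop) (Filter.Eventually.of_forall fun _ => le_rfl)
  exact (P.integrable_g.add (h.smul P.α)).inner_const e

lemma integrable_D (e : Ed d) : Integrable (P.D e) := by
  refine (P.integrable_ρ_iff.1 (P.integrable_inner_grad e)).neg.congr
    (Filter.Eventually.of_forall fun z => ?_)
  simp [D, mul_comm]

lemma sub_eq_integral_D {e : Ed d}
    (he : ∀ᵐ z, ∀ t : ℝ, z + t • e ∈ frontier P.O → ContinuousAt P.p (z + t • e))
    {h : ℝ} (hh : 0 < h) :
    ∀ᵐ z, P.p (z + h • e) - P.p z = ∫ s in (0 : ℝ)..h, P.D e (z + s • e) := by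
  filter_upwards [he, ae_ae_add_smul P.grad e,
    ae_integrableOn_add_smul (P.measurable_D e) (P.integrable_D e) e h] with z hz hg hi
  have hcont : Continuous fun t : ℝ => z + t • e := by fun_prop
  have key := sub_eq_integral_of_eqOn_exp_neg (φ := fun t => P.p (z + t • e))
    (D := fun t => P.D e (z + t • e)) hh (P.isOpen.preimage hcont) (P.convexOn_line z e)
    (fun t ht => P.p_eq_exp_neg_V ht) (fun t ht => P.p_of_notMem ht)
    (continuous_iff_continuousAt.2 fun t =>
      (P.continuousAt_p (hz t)).comp_of_eq hcont.continuousAt rfl) hi ?_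
    (fun t ht => by simp [D, P.p_of_notMem (show z + t • e ∉ P.O from ht)])
  · simpa using key
  · filter_upwards [hg] with t ht htO
    have h1 := P.hasDerivAt_p_lineMap htO (ht htO) e
    have h2 := HasDerivAt.comp_sub_const t t (by rwa [sub_self])
    refine h2.congr_of_eventuallyEq (Filter.Eventually.of_forall fun s => ?_)
    simp only
    congr 1
    module

lemma ae_line_continuousAt (hN : μH[(d : ℝ) - 1] {x ∈ frontier P.O | ¬ContinuousAt P.p x} = 0)
    (i : Fin d) : ∀ᵐ z, ∀ t : ℝ, z + t • WithLp.toLp 2 (Pi.single i 1) ∈ frontier P.O →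
      ContinuousAt P.p (z + t • WithLp.toLp 2 (Pi.single i 1)) := by
  cases d with
  | zero => exact i.elim0
  | succ m =>
    rw [Nat.cast_succ, add_sub_cancel_right] at hN
    filter_upwards [(PiLp.volume_preserving_ofLp (Fin (m + 1))).quasiMeasurePreserving.ae
      (ae_line_notMem_of_hausdorffMeasure_eq_zero i hN)] with z hz t ht
    by_contra hc
    exact hz t ⟨ht, hc⟩

lemma inner_single (z : Ed d) (i : Fin d) : ⟪z, WithLp.toLp 2 (Pi.single i 1)⟫ = z i := by
  have := EuclideanSpace.inner_single_right (𝕜 := ℝ) i 1 z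
  simpa using this

lemma D_single (i : Fin d) (z : Ed d) :
    P.D (WithLp.toLp 2 (Pi.single i 1)) z = -((P.g z i + P.α * z i) * P.p z) := by
  rw [D, inner_single]
  simp

lemma ae_sub_eq_integral_D
    (hN : μH[(d : ℝ) - 1] {x ∈ frontier P.O | ¬ContinuousAt P.p x} = 0) (i : Fin d) {h : ℝ}
    (hh : 0 < h) : ∀ᵐ x : Fin d → ℝ,
      P.p (WithLp.toLp 2 (x + h • Pi.single i 1)) - P.p (WithLp.toLp 2 x) =
        ∫ s in (0 : ℝ)..h, P.D (WithLp.toLp 2 (Pi.single i 1))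
          (WithLp.toLp 2 (x + s • Pi.single i 1)) :=
  (PiLp.volume_preserving_toLp (Fin d)).quasiMeasurePreserving.ae
    (P.sub_eq_integral_D (P.ae_line_continuousAt hN i) hh)

lemma integrable_comp_toLp {F : Ed d → ℝ} (hF : Integrable F) :
    Integrable fun x : Fin d → ℝ => F (WithLp.toLp 2 x) :=
  (PiLp.volume_preserving_toLp (Fin d)).integrable_comp_of_integrable hF

lemma integral_comp_toLp (F : Ed d → ℝ) : ∫ x : Fin d → ℝ, F (WithLp.toLp 2 x) = ∫ z, F z :=
  (PiLp.volume_preserving_toLp (Fin d)).integral_comp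
    (MeasurableEquiv.toLp 2 (Fin d → ℝ)).measurableEmbedding F

lemma integral_inner_grad_eq_zero
    (hN : μH[(d : ℝ) - 1] {x ∈ frontier P.O | ¬ContinuousAt P.p x} = 0) (v : Ed d) :
    ∫ z, ⟪P.g z + P.α • z, v⟫ ∂P.ρ = 0 := by
  have h1 : ∀ i : Fin d, ∫ z, ⟪P.g z + P.α • z, WithLp.toLp 2 (Pi.single i 1)⟫ ∂P.ρ = 0 := by
    intro i
    have h2 := integral_eq_zero_of_translate (integrable_comp_toLp P.integrable_p)
      ((P.measurable_D (WithLp.toLp 2 (Pi.single i 1))).comp (WithLp.measurable_toLp 2 _))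
      (integrable_comp_toLp (P.integrable_D _)) (P.ae_sub_eq_integral_D hN i one_pos)
    have h3 := integral_comp_toLp (P.D (WithLp.toLp 2 (Pi.single i 1)))
    rw [integral_ρ, ← neg_eq_zero, ← integral_neg, ← h2]
    simp only [Function.comp_def]
    rw [h3]
    refine integral_congr_ae (Filter.Eventually.of_forall fun z => ?_)
    simp [D, mul_comm]
  have h4 : ∀ z, ⟪P.g z + P.α • z, v⟫ =
      ∑ i, v i * ⟪P.g z + P.α • z, WithLp.toLp 2 (Pi.single i 1)⟫ := fun z => by
    simp_rw [inner_single]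
    simp [PiLp.inner_apply]
  simp_rw [h4]
  rw [integral_finsetSum _ fun i _ => (P.integrable_inner_grad _).const_mul _]
  simp_rw [integral_const_mul, h1]
  simp

lemma boundsMonotoneDeriv
    (hN : μH[(d : ℝ) - 1] {x ∈ frontier P.O | ¬ContinuousAt P.p x} = 0) (R : ℝ) :
    BoundsMonotoneDeriv R (fun x => ENNReal.ofReal (P.p (WithLp.toLp 2 x))) fun i ζ =>
      ∫ z, ζ (WithLp.ofLp z) * (P.g z i + P.α * z i) ∂P.ρ := by
  have h := boundsMonotoneDeriv_of_translate (R := R)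
    (p := fun x : Fin d → ℝ => P.p (WithLp.toLp 2 x))
    (D := fun i x => P.D (WithLp.toLp 2 (Pi.single i 1)) (WithLp.toLp 2 x))
    (fun _ => P.p_nonneg _) (P.measurable_p.comp (WithLp.measurable_toLp 2 _))
    (integrable_comp_toLp P.integrable_p)
    (fun i => (P.measurable_D _).comp (WithLp.measurable_toLp 2 _))
    (fun i => integrable_comp_toLp (P.integrable_D _)) (fun i x hx => by simp [D, hx])
    (fun i _ hh => P.ae_sub_eq_integral_D hN i hh)
  convert h using 3 with i ζ
  have h3 := integral_comp_toLp
    fun z => ζ (WithLp.ofLp z) * P.D (WithLp.toLp 2 (Pi.single i 1)) z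
  rw [h3, integral_ρ, ← integral_neg]
  refine integral_congr_ae (Filter.Eventually.of_forall fun z => ?_)
  simp only [D_single]
  ring

end GibbsDensity

section SignedIntegral

variable {X : Type*} [MeasurableSpace X] {ν : Measure X} {f h : X → ℝ}

lemma sInt_of_integrable (hf : Integrable f ν) : sInt ν f = ((∫ x, f x ∂ν : ℝ) : EReal) := by
  have h1 : ∫⁻ x, ENNReal.ofReal (f x) ∂ν ≠ ⊤ := hf.lintegral_lt_top.ne
  have h2 : ∫⁻ x, ENNReal.ofReal (-f x) ∂ν ≠ ⊤ := hf.neg.lintegral_lt_top.ne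
  rw [sInt, integral_eq_lintegral_pos_part_sub_lintegral_neg_part hf, EReal.coe_sub,
    EReal.coe_ennreal_toReal h1, EReal.coe_ennreal_toReal h2]

lemma sInt_congr_ae (hfh : f =ᵐ[ν] h) : sInt ν f = sInt ν h := by
  rw [sInt, sInt]
  congr 2
  · exact lintegral_congr_ae (hfh.mono fun x hx => by simp only [hx])
  · exact lintegral_congr_ae (hfh.mono fun x hx => by simp only [hx])

lemma sInt_mono_ae (hfh : ∀ᵐ x ∂ν, f x ≤ h x) : sInt ν f ≤ sInt ν h := by
  refine EReal.sub_le_sub ?_ ?_ <;> rw [EReal.coe_ennreal_le_coe_ennreal_iff]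
  · exact lintegral_mono_ae (hfh.mono fun x hx => ENNReal.ofReal_le_ofReal hx)
  · exact lintegral_mono_ae (hfh.mono fun x hx => ENNReal.ofReal_le_ofReal (neg_le_neg hx))

lemma sInt_ne_bot (hf : ∫⁻ x, ENNReal.ofReal (-f x) ∂ν ≠ ⊤) : sInt ν f ≠ ⊥ := by
  rw [sInt, sub_eq_add_neg, Ne, EReal.add_eq_bot_iff]
  simp [hf]

lemma integrable_of_sInt_ne_top (hm : AEStronglyMeasurable f ν)
    (hf : ∫⁻ x, ENNReal.ofReal (-f x) ∂ν ≠ ⊤) (h : sInt ν f ≠ ⊤) : Integrable f ν := by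
  have h1 : ∫⁻ x, ENNReal.ofReal (f x) ∂ν ≠ ⊤ := by
    intro htop
    rw [sInt, htop, ← EReal.coe_ennreal_toReal hf] at h
    exact h (EReal.top_sub_coe _)
  refine ⟨hm, ?_⟩
  rw [hasFiniteIntegral_iff_norm]
  calc ∫⁻ x, ENNReal.ofReal ‖f x‖ ∂ν
      ≤ ∫⁻ x, ENNReal.ofReal (f x) + ENNReal.ofReal (-f x) ∂ν := by
        refine lintegral_mono fun x => ?_
        rcases le_total 0 (f x) with h0 | h0
        · rw [Real.norm_of_nonneg h0]; exact le_self_add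
        · rw [Real.norm_of_nonpos h0]; exact le_add_self
    _ = _ := lintegral_add_left' hm.aemeasurable.ennreal_ofReal _
    _ < ⊤ := ENNReal.add_lt_top.2 ⟨h1.lt_top, hf.lt_top⟩

end SignedIntegral

namespace GibbsDensity

variable {d : ℕ} (P : GibbsDensity d)

/-- The law of the gradient of the potential. -/
def μ : Measure (Ed d) := P.ρ.map P.g

instance : IsProbabilityMeasure P.μ :=
  Measure.isProbabilityMeasure_map P.measurable_g.aemeasurable

lemma integrable_norm_μ : Integrable (fun y => ‖y‖) P.μ :=
  (integrable_map_measure (by fun_prop) P.measurable_g.aemeasurable).2 P.integrable_g.norm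

lemma rnDeriv_ρ : P.ρ.rnDeriv volume =ᵐ[volume] fun x => ENNReal.ofReal (P.p x) :=
  Measure.rnDeriv_withDensity _ P.measurable_p.ennreal_ofReal

lemma Ent_ρ : Ent P.ρ = ((-∫ z, P.V z ∂P.ρ : ℝ) : EReal) := by
  have h1 : P.ρ ≪ volume := withDensity_absolutelyContinuous _ _
  have h2 : (fun x => (P.ρ.rnDeriv volume x).toReal * Real.log (P.ρ.rnDeriv volume x).toReal)
      =ᵐ[volume] fun x => P.p x * -P.V x := by
    filter_upwards [P.rnDeriv_ρ] with x hx
    rw [hx, ENNReal.toReal_ofReal (P.p_nonneg x)]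
    by_cases h : x ∈ P.O
    · rw [P.p_eq_exp_neg_V h, Real.log_exp]
    · simp [P.p_of_notMem h]
  have h3 : Integrable fun x => P.p x * -P.V x := P.integrable_ρ_iff.1 P.integrable_V.neg
  rw [Ent, dif_pos h1, sInt_congr_ae h2, sInt_of_integrable h3,
    ← P.integral_ρ fun x => -P.V x, integral_neg]

lemma M2e_ρ : M2e P.ρ = ENNReal.ofReal (∫ z, ‖z‖ ^ 2 ∂P.ρ) := by
  rw [M2e, ofReal_integral_eq_lintegral_ofReal P.integrable_sq
    (Filter.Eventually.of_forall fun _ => by positivity)]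

lemma nonempty_O : P.O.Nonempty := by
  obtain ⟨w, hw, -⟩ := P.exists_mem_grad
  exact ⟨w, hw⟩

/-- A dense sequence of points of the domain. -/
lemma exists_dense_seq : ∃ w : ℕ → Ed d, (∀ n, w n ∈ P.O) ∧ P.O ⊆ closure (Set.range w) := by
  have : Nonempty P.O := P.nonempty_O.to_subtype
  refine ⟨fun n => TopologicalSpace.denseSeq P.O n, fun n => Subtype.coe_prop _, fun x hx => ?_⟩
  have h := (TopologicalSpace.denseRange_denseSeq P.O) ⟨x, hx⟩
  have h2 := image_closure_subset_closure_image continuous_subtype_val (Set.mem_image_of_mem _ h)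
  rwa [← Set.range_comp] at h2

lemma exists_conjugate : ∃ fc : Ed d → ℝ, Measurable fc ∧
    (∀ᵐ y ∂P.μ, ∀ x ∈ P.O, ⟪x, y⟫ ≤ P.f x + fc y) ∧
    ∀ᵐ z ∂P.ρ, fc (P.g z) = ⟪P.g z, z⟫ - P.f z := by
  obtain ⟨w, hw, hdense⟩ := P.exists_dense_seq
  have hm : ∀ n, Measurable fun y : Ed d => ⟪w n, y⟫ - P.f (w n) := fun n => by fun_prop
  have hle : ∀ y, BddAbove (Set.range fun n => ⟪w n, y⟫ - P.f (w n)) →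
      ∀ x ∈ P.O, ⟪x, y⟫ - P.f x ≤ ⨆ n, (⟪w n, y⟫ - P.f (w n)) := by
    intro y hy x hx
    have h1 : ContinuousAt (fun x => ⟪x, y⟫ - P.f x) x :=
      (by fun_prop : ContinuousAt (fun x : Ed d => ⟪x, y⟫) x).sub
        (P.continuousOn_f.continuousAt (P.isOpen.mem_nhds hx))
    by_contra! hlt
    have h2 := mem_closure_iff_nhds.1 (hdense hx) _ (h1.preimage_mem_nhds (Ioi_mem_nhds hlt))
    obtain ⟨_, h3, n, rfl⟩ := h2
    exact (not_lt.2 (le_ciSup hy n)) h3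
  have hbdd : ∀ᵐ z ∂P.ρ, ∀ x ∈ P.O, ⟪x, P.g z⟫ - P.f x ≤ ⟪P.g z, z⟫ - P.f z := by
    filter_upwards [P.ae_mem, P.ae_grad] with z hz hg x hx
    have h1 := P.convexOn.add_inner_gradient_le hz hx hg
    rw [inner_sub_right, real_inner_comm] at h1
    linarith
  have hB : ∀ᵐ z ∂P.ρ, BddAbove (Set.range fun n => ⟪w n, P.g z⟫ - P.f (w n)) := by
    filter_upwards [hbdd] with z hz
    exact ⟨_, Set.forall_mem_range.2 fun n => hz _ (hw n)⟩
  refine ⟨fun y => ⨆ n, (⟪w n, y⟫ - P.f (w n)), Measurable.iSup hm, ?_, ?_⟩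
  · have h1 : ∀ᵐ y ∂P.μ, BddAbove (Set.range fun n => ⟪w n, y⟫ - P.f (w n)) :=
      (ae_map_iff P.measurable_g.aemeasurable (measurableSet_bddAbove_range hm)).2 hB
    filter_upwards [h1] with y hy x hx
    linarith [hle y hy x hx]
  · filter_upwards [hB, hbdd, P.ae_mem] with z hz hz' hzO
    refine le_antisymm (ciSup_le fun n => hz' _ (hw n)) ?_
    rw [real_inner_comm]
    exact hle _ hz z hzO

lemma maxCorr_le : maxCorr P.ρ P.μ ≤ ((∫ z, ⟪P.g z, z⟫ ∂P.ρ : ℝ) : EReal) := by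
  obtain ⟨fc, hfcm, hfc, hfcg⟩ := P.exists_conjugate
  refine iSup₂_le fun γ ⟨hγ, h1, h2⟩ => ?_
  have hc1 : Integrable (fc ∘ P.g) P.ρ :=
    (P.integrable_inner.sub P.integrable_f).congr (hfcg.mono fun z hz => hz.symm)
  have hc : Integrable fc P.μ :=
    (integrable_map_measure hfcm.aestronglyMeasurable P.measurable_g.aemeasurable).2 hc1
  have hcint : ∫ y, fc y ∂P.μ = ∫ z, ⟪P.g z, z⟫ ∂P.ρ - ∫ z, P.f z ∂P.ρ := by
    rw [μ, integral_map P.measurable_g.aemeasurable hfcm.aestronglyMeasurable,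
      integral_congr_ae hfcg, integral_sub P.integrable_inner P.integrable_f]
  have hf1 : Integrable (fun q => P.f q.1) γ := by
    have h := P.integrable_f
    rw [← h1] at h
    exact h.comp_measurable measurable_fst
  have hf2 : Integrable (fun q => fc q.2) γ := by
    rw [← h2] at hc
    exact hc.comp_measurable measurable_snd
  have hle : ∀ᵐ q ∂γ, ⟪q.1, q.2⟫ ≤ P.f q.1 + fc q.2 := by
    have hO := P.ae_mem
    rw [← h1] at hO
    rw [← h2] at hfc
    filter_upwards [ae_of_ae_map measurable_fst.aemeasurable hO,
      ae_of_ae_map measurable_snd.aemeasurable hfc] with q hq1 hq2 using hq2 _ hq1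
  refine (sInt_mono_ae hle).trans ?_
  have hf12 : Integrable (fun q => P.f q.1 + fc q.2) γ := hf1.add hf2
  rw [sInt_of_integrable hf12, integral_add hf1 hf2]
  have e1 : ∫ q, P.f q.1 ∂γ = ∫ z, P.f z ∂P.ρ := by
    conv_rhs => rw [← h1]
    rw [integral_map measurable_fst.aemeasurable (h1 ▸ P.integrable_f.1)]
  have e2 : ∫ q, fc q.2 ∂γ = ∫ y, fc y ∂P.μ := by
    conv_rhs => rw [← h2]
    rw [integral_map measurable_snd.aemeasurable hfcm.aestronglyMeasurable]
  rw [e1, e2, hcint]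
  exact_mod_cast le_of_eq (by ring)

/-- The value of the regularized functional at the Gibbs density. -/
def K : ℝ := -∫ z, P.V z ∂P.ρ + d - P.α / 2 * ∫ z, ‖z‖ ^ 2 ∂P.ρ

lemma Ffun_ρ_le (h0 : ∀ v : Ed d, ∫ z, ⟪P.g z + P.α • z, v⟫ ∂P.ρ = 0) :
    Ffun P.α P.μ P.ρ ≤ (P.K : EReal) := by
  have h1 : ((M2e P.ρ : ℝ≥0∞) : EReal) = ((∫ z, ‖z‖ ^ 2 ∂P.ρ : ℝ) : EReal) := by
    rw [M2e_ρ, EReal.coe_ennreal_ofReal, max_eq_left (integral_nonneg fun _ => by positivity)]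
  rw [Ffun, Ent_ρ, h1]
  refine (add_le_add_left (add_le_add_right P.maxCorr_le _) _).trans ?_
  have h2 := P.integral_inner_le h0
  norm_cast
  rw [K]
  linarith

end GibbsDensity

lemma map_ofLp_withDensity {d : ℕ} {F : Ed d → ℝ≥0∞} (hF : Measurable F) :
    ((volume : Measure (Ed d)).withDensity F).map WithLp.ofLp =
      volume.withDensity fun x : Fin d → ℝ => F (WithLp.toLp 2 x) := by
  ext A hA
  have hm : Measurable fun x : Fin d → ℝ => F (WithLp.toLp 2 x) :=
    hF.comp (WithLp.measurable_toLp 2 _)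
  rw [Measure.map_apply (WithLp.measurable_ofLp 2 _) hA, withDensity_apply _ hA,
    withDensity_apply _ (hA.preimage (WithLp.measurable_ofLp 2 _)),
    ← (PiLp.volume_preserving_ofLp (Fin d)).setLIntegral_comp_preimage hA hm]

lemma map_toLp_withDensity {d : ℕ} {F : Ed d → ℝ≥0∞} (hF : Measurable F) :
    (volume.withDensity fun x : Fin d → ℝ => F (WithLp.toLp 2 x)).map (WithLp.toLp 2) =
      (volume : Measure (Ed d)).withDensity F := by
  rw [← map_ofLp_withDensity hF, Measure.map_map (WithLp.measurable_toLp 2 _)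
    (WithLp.measurable_ofLp 2 _)]
  exact Measure.map_id

section RealDensity

variable {X : Type*} [MeasurableSpace X] {ν : Measure X} {F G : X → ℝ}

lemma integrable_withDensity_ofReal_iff (hF : Measurable F) (hF0 : ∀ x, 0 ≤ F x) :
    Integrable G (ν.withDensity fun x => ENNReal.ofReal (F x)) ↔
      Integrable (fun x => F x * G x) ν := by
  rw [integrable_withDensity_iff_integrable_smul' hF.ennreal_ofReal
    (Filter.Eventually.of_forall fun _ => ofReal_lt_top)]
  refine integrable_congr (Filter.Eventually.of_forall fun x => ?_)
  simp [ENNReal.toReal_ofReal (hF0 x)]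

lemma integral_withDensity_ofReal (hF : Measurable F) (hF0 : ∀ x, 0 ≤ F x) :
    ∫ x, G x ∂(ν.withDensity fun x => ENNReal.ofReal (F x)) = ∫ x, F x * G x ∂ν := by
  rw [integral_withDensity_eq_integral_toReal_smul hF.ennreal_ofReal
    (Filter.Eventually.of_forall fun _ => ofReal_lt_top)]
  simp [ENNReal.toReal_ofReal (hF0 _)]

end RealDensity

namespace GibbsDensity

variable {d : ℕ} (P : GibbsDensity d)

lemma integrable_inner_of_bounded {S : Ed d → Ed d} (hS : Measurable S) {R : ℝ}
    (hSR : ∀ z, ‖S z‖ ≤ R) : Integrable (fun z => ⟪S z, P.g z⟫) P.ρ := by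
  have := P.measurable_g
  refine (P.integrable_g.norm.const_mul R).mono' (by fun_prop)
    (Filter.Eventually.of_forall fun z => (norm_inner_le_norm _ _).trans ?_)
  exact mul_le_mul_of_nonneg_right (hSR z) (norm_nonneg _)

lemma norm_le_of_forall_mem_Icc {x : Ed d} {R : ℝ} (h : ∀ i, x i ∈ Set.Icc (-R) R) :
    ‖x‖ ≤ √(d * R ^ 2) := by
  rw [EuclideanSpace.norm_eq]
  refine Real.sqrt_le_sqrt ?_
  calc ∑ i, ‖x i‖ ^ 2 ≤ ∑ _i : Fin d, R ^ 2 := Finset.sum_le_sum fun i _ => by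
        rw [Real.norm_eq_abs, sq_abs]
        exact sq_le_sq' (h i).1 (h i).2
    _ = _ := by simp

lemma exists_transport
    (hN : μH[(d : ℝ) - 1] {x ∈ frontier P.O | ¬ContinuousAt P.p x} = 0) {R : ℝ} (hR : 1 ≤ R)
    {F : Ed d → ℝ} (hF : Measurable F) (hF0 : ∀ x, 0 ≤ F x)
    (hF1 : ∫⁻ x, ENNReal.ofReal (F x) = 1)
    (hFR : ∀ x, F x ≠ 0 → ∀ i, x i ∈ Set.Icc (-R) R)
    (hFlog : Integrable fun x => F x * Real.log (F x)) :
    ∃ S : Ed d → Ed d, Measurable S ∧ (∀ z i, S z i ∈ Set.Icc (-R) R) ∧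
      P.ρ.map S = volume.withDensity (fun x => ENNReal.ofReal (F x)) ∧
      -∫ z, P.V z ∂P.ρ + d ≤ (∫ x, F x * Real.log (F x)) +
        ∫ z, ⟪S z, P.g z + P.α • z⟫ ∂P.ρ := by
  have htoLp : Measurable (WithLp.toLp 2 : (Fin d → ℝ) → Ed d) := WithLp.measurable_toLp 2 _
  have hofLp : Measurable (WithLp.ofLp : Ed d → Fin d → ℝ) := WithLp.measurable_ofLp 2 _
  have hvol := PiLp.volume_preserving_toLp (Fin d)
  have hpm : Measurable fun z => ENNReal.ofReal (P.p z) := P.measurable_p.ennreal_ofReal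
  obtain ⟨S, r, hS, hr, hr0, hSR, hmap, hint, hae⟩ := exists_triangular_transport hR
    (p := fun x => ENNReal.ofReal (P.p (WithLp.toLp 2 x)))
    (q := fun x => ENNReal.ofReal (F (WithLp.toLp 2 x))) (hpm.comp htoLp)
    (hF.ennreal_ofReal.comp htoLp)
    (by rw [hvol.lintegral_comp hpm, P.lintegral_p])
    (by rw [hvol.lintegral_comp hF.ennreal_ofReal, hF1])
    (fun x hx => hFR (WithLp.toLp 2 x) fun h0 => hx (by simp [h0]))
    (P.boundsMonotoneDeriv hN R)
  have hρ : P.ρ.map WithLp.ofLp =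
      volume.withDensity fun x : Fin d → ℝ => ENNReal.ofReal (P.p (WithLp.toLp 2 x)) :=
    map_ofLp_withDensity hpm
  set T : Ed d → Ed d := fun z => WithLp.toLp 2 (S (WithLp.ofLp z)) with hT
  have hTm : Measurable T := htoLp.comp (hS.comp hofLp)
  have hTmap : P.ρ.map T = volume.withDensity fun x => ENNReal.ofReal (F x) := by
    rw [← map_toLp_withDensity hF.ennreal_ofReal, ← hmap, ← hρ, Measure.map_map hS hofLp,
      Measure.map_map htoLp (hS.comp hofLp)]
    rfl
  have hTn : ∀ z, ‖T z‖ ≤ √(d * R ^ 2) := fun z => norm_le_of_forall_mem_Icc fun i => hSR _ i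
  set ℓ : Fin d → Ed d → ℝ := fun i z => T z i * (P.g z i + P.α * z i) with hℓ
  have hℓi : ∀ i, Integrable (ℓ i) P.ρ := by
    intro i
    have h1 := P.integrable_inner_grad (WithLp.toLp 2 (Pi.single i 1))
    simp only [inner_single] at h1
    refine h1.bdd_mul (c := R) (by fun_prop) (Filter.Eventually.of_forall fun z => ?_)
    exact abs_le.2 (hSR _ i)
  have hae' : ∀ᵐ z ∂P.ρ, ENNReal.ofReal (P.p z) =
      ENNReal.ofReal (F (T z)) * ∏ i, ENNReal.ofReal (r i (WithLp.ofLp z)) := by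
    rw [← hρ] at hae
    exact ae_of_ae_map hofLp.aemeasurable hae
  have hpos : ∀ᵐ z ∂P.ρ, 0 < F (T z) ∧ (∀ i, 0 < r i (WithLp.ofLp z)) ∧
      P.p z = F (T z) * ∏ i, r i (WithLp.ofLp z) := by
    filter_upwards [hae', P.ae_mem] with z hz hzO
    rw [← ENNReal.ofReal_prod_of_nonneg fun i _ => hr0 i _,
      ← ENNReal.ofReal_mul (hF0 _)] at hz
    have h1 := (ENNReal.ofReal_eq_ofReal_iff (P.p_nonneg z)
      (mul_nonneg (hF0 _) (Finset.prod_nonneg fun i _ => hr0 i _))).1 hz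
    have h2 := P.p_pos_iff.2 hzO
    rw [h1] at h2
    refine ⟨pos_of_mul_pos_left h2 (Finset.prod_nonneg fun i _ => hr0 i _), fun i => ?_, h1⟩
    have h3 := (pos_of_mul_pos_right h2 (hF0 _)).ne'
    exact (hr0 i _).lt_of_ne' (Finset.prod_ne_zero_iff.1 h3 i (Finset.mem_univ i))
  have hrint : ∀ i, ∫⁻ z, ENNReal.ofReal (r i (WithLp.ofLp z)) ∂P.ρ ≤
      ENNReal.ofReal (∫ z, ℓ i z ∂P.ρ) := by
    intro i
    have h1 : ∫⁻ z, ENNReal.ofReal (r i (WithLp.ofLp z)) ∂P.ρ =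
        ∫⁻ x, ENNReal.ofReal (P.p (WithLp.toLp 2 x)) * ENNReal.ofReal (r i x) := by
      rw [← lintegral_map (hr i).ennreal_ofReal hofLp, hρ]
      exact lintegral_withDensity_eq_lintegral_mul _ (hpm.comp htoLp) (hr i).ennreal_ofReal
    exact h1.trans_le (hint i)
  have hri : ∀ i, Integrable (fun z => r i (WithLp.ofLp z)) P.ρ := fun i => by
    refine ⟨((hr i).comp hofLp).aestronglyMeasurable, ?_⟩
    rw [hasFiniteIntegral_iff_ofReal (Filter.Eventually.of_forall fun z => hr0 i _)]
    exact (hrint i).trans_lt ofReal_lt_top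
  have hrle : ∀ i, ∫ z, r i (WithLp.ofLp z) ∂P.ρ ≤ ∫ z, ℓ i z ∂P.ρ := by
    intro i
    have h1 := hrint i
    rw [← ofReal_integral_eq_lintegral_ofReal (hri i)
      (Filter.Eventually.of_forall fun z => hr0 i _)] at h1
    have h2 : 0 < ∫ z, r i (WithLp.ofLp z) ∂P.ρ := by
      rw [integral_pos_iff_support_of_nonneg (fun z => hr0 i _) (hri i)]
      have h3 : P.ρ (Function.support fun z => r i (WithLp.ofLp z)) = 1 :=
        (prob_compl_eq_zero_iff (measurableSet_support ((hr i).comp hofLp))).1 (by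
          refine measure_mono_null (fun z hz => ?_) (ae_iff.1 hpos)
          simp only [Set.mem_compl_iff, Function.mem_support, not_not] at hz
          intro h
          exact (h.2.1 i).ne' hz)
      simp [h3]
    by_contra! hlt
    exact (not_lt.2 h1) ((ENNReal.ofReal_lt_ofReal_iff h2).2 hlt)
  have hlogF : Integrable (fun z => Real.log (F (T z))) P.ρ := by
    have h1 : Integrable (fun x => Real.log (F x)) (P.ρ.map T) := by
      rw [hTmap, integrable_withDensity_ofReal_iff hF hF0]
      exact hFlog
    exact h1.comp_measurable hTm
  have hlogF' : ∫ z, Real.log (F (T z)) ∂P.ρ = ∫ x, F x * Real.log (F x) := by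
    rw [← integral_withDensity_ofReal hF hF0, ← hTmap]
    exact (integral_map hTm.aemeasurable (Real.measurable_log.comp hF).aestronglyMeasurable).symm
  refine ⟨T, hTm, fun z => hSR _, hTmap, ?_⟩
  have hle : ∀ᵐ z ∂P.ρ, -P.V z ≤ Real.log (F (T z)) + ∑ i, (r i (WithLp.ofLp z) - 1) := by
    filter_upwards [hpos, P.ae_mem] with z ⟨h1, h2, h3⟩ hzO
    have h4 : -P.V z = Real.log (P.p z) := by rw [P.p_eq_exp_neg_V hzO, Real.log_exp]
    rw [h4, h3, Real.log_mul h1.ne' (Finset.prod_ne_zero_iff.2 fun i _ => (h2 i).ne'),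
      Real.log_prod fun i _ => (h2 i).ne']
    gcongr with i
    exact Real.log_le_sub_one_of_pos (h2 i)
  have hri1 : ∀ i ∈ Finset.univ, Integrable (fun z => r i (WithLp.ofLp z) - 1) P.ρ :=
    fun i _ => (hri i).sub (integrable_const 1)
  have hsum : Integrable (fun z => ∑ i, (r i (WithLp.ofLp z) - 1)) P.ρ :=
    integrable_finsetSum _ hri1
  have hmono := integral_mono_ae P.integrable_V.neg (hlogF.add hsum) hle
  rw [integral_neg', integral_add' hlogF hsum, hlogF',
    integral_finsetSum _ hri1] at hmono
  have hsum2 : ∑ i, ∫ z, (r i (WithLp.ofLp z) - 1) ∂P.ρ ≤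
      ∫ z, ⟪T z, P.g z + P.α • z⟫ ∂P.ρ - d := by
    have h1 : ∀ z, ⟪T z, P.g z + P.α • z⟫ = ∑ i, ℓ i z := fun z => by
      simp [PiLp.inner_apply, hℓ, mul_comm]
    simp_rw [h1]
    rw [integral_finsetSum _ fun i _ => hℓi i]
    have h2 : (d : ℝ) = ∑ _i : Fin d, (1 : ℝ) := by simp
    rw [h2, ← Finset.sum_sub_distrib]
    refine Finset.sum_le_sum fun i _ => ?_
    rw [integral_sub (hri i) (integrable_const 1)]
    simpa using hrle i
  linarith

end GibbsDensity

lemma integrable_one_add_norm_rpow_dim (d : ℕ) :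
    Integrable fun x : Ed d => (1 + ‖x‖) ^ (-((d : ℝ) + 1)) :=
  integrable_one_add_norm (by simp)

lemma neg_mul_log_le {t a : ℝ} (ht : 0 ≤ t) : -(t * Real.log t) ≤ t * a + Real.exp (-a) := by
  rcases ht.eq_or_lt with rfl | ht
  · simpa using (Real.exp_pos _).le
  have h := Real.add_one_le_exp (-a - Real.log t)
  rw [sub_eq_add_neg, Real.exp_add, Real.exp_neg (Real.log t), Real.exp_log ht] at h
  have h2 := mul_le_mul_of_nonneg_left h ht.le
  have h3 : t * (Real.exp (-a) * t⁻¹) = Real.exp (-a) := by field_simp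
  nlinarith

/-- The negative part of the entropy density is integrable under a first moment condition. -/
lemma lintegral_neg_mul_log_ne_top {d : ℕ} {F : Ed d → ℝ}
    (hF0 : ∀ x, 0 ≤ F x) (hF1 : Integrable fun x => F x * ‖x‖) :
    ∫⁻ x, ENNReal.ofReal (-(F x * Real.log (F x))) ≠ ⊤ := by
  have h1 := (hF1.const_mul ((d : ℝ) + 1)).add (integrable_one_add_norm_rpow_dim d)
  refine ne_top_of_le_ne_top h1.lintegral_lt_top.ne (lintegral_mono fun x => ?_)
  refine ENNReal.ofReal_le_ofReal ?_
  have h0 : 0 < 1 + ‖x‖ := by positivity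
  have h2 := neg_mul_log_le (a := ((d : ℝ) + 1) * Real.log (1 + ‖x‖)) (hF0 x)
  have h3 : Real.log (1 + ‖x‖) ≤ ‖x‖ := by
    have := Real.log_le_sub_one_of_pos h0
    linarith
  have h4 : Real.exp (-(((d : ℝ) + 1) * Real.log (1 + ‖x‖))) = (1 + ‖x‖) ^ (-((d : ℝ) + 1)) := by
    rw [Real.rpow_def_of_pos h0]
    ring_nf
  rw [h4] at h2
  refine h2.trans (add_le_add_left ?_ _)
  have h5 : (0 : ℝ) ≤ (d : ℝ) + 1 := by positivity
  calc F x * (((d : ℝ) + 1) * Real.log (1 + ‖x‖)) ≤ F x * (((d : ℝ) + 1) * ‖x‖) :=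
        mul_le_mul_of_nonneg_left (mul_le_mul_of_nonneg_left h3 h5) (hF0 x)
    _ = _ := by ring

/-- The coordinate cube of half-width `R`. -/
def cube (d : ℕ) (R : ℝ) : Set (Ed d) := {x | ∀ i, x i ∈ Set.Icc (-R) R}

lemma measurableSet_cube (d : ℕ) (R : ℝ) : MeasurableSet (cube d R) := by
  have h : cube d R = ⋂ i, (fun x : Ed d => x i) ⁻¹' Set.Icc (-R) R := by
    ext x
    simp [cube]
  rw [h]
  refine MeasurableSet.iInter fun i => ?_
  have : Measurable fun x : Ed d => x i := by fun_prop
  exact this measurableSet_Icc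

lemma cube_mono (d : ℕ) : Monotone fun n : ℕ => cube d n := fun m n h x hx i => by
  have h' : (m : ℝ) ≤ n := by exact_mod_cast h
  exact ⟨(neg_le_neg h').trans (hx i).1, (hx i).2.trans h'⟩

lemma iUnion_cube (d : ℕ) : ⋃ n : ℕ, cube d n = Set.univ := by
  refine Set.eq_univ_of_forall fun x => Set.mem_iUnion.2 ?_
  obtain ⟨n, hn⟩ := exists_nat_ge ‖x‖
  exact ⟨n, fun i => abs_le.1 ((PiLp.norm_apply_le x i).trans hn)⟩

section Couplings

variable {d : ℕ} {σ μ : Measure (Ed d)}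

lemma integrable_inner_prod [SFinite σ] [SFinite μ] (hσ : Integrable (fun x => ‖x‖) σ)
    (hμ : Integrable (fun x => ‖x‖) μ) :
    Integrable (fun q : Ed d × Ed d => ⟪q.1, q.2⟫) (σ.prod μ) :=
  (hσ.mul_prod hμ).mono' (by fun_prop)
    (Filter.Eventually.of_forall fun q => norm_inner_le_norm _ _)

variable [IsProbabilityMeasure σ] [IsProbabilityMeasure μ]

lemma prod_mem_couplings : σ.prod μ ∈ couplings σ μ :=
  ⟨inferInstance, by simp [Measure.map_fst_prod], by simp [Measure.map_snd_prod]⟩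

lemma maxCorr_ne_bot (hσ : Integrable (fun x => ‖x‖) σ) (hμ : Integrable (fun x => ‖x‖) μ) :
    maxCorr σ μ ≠ ⊥ := by
  intro h
  have h1 : sInt (σ.prod μ) (fun p => ⟪p.1, p.2⟫) ≤ maxCorr σ μ :=
    le_iSup₂_of_le _ prod_mem_couplings le_rfl
  rw [h, sInt_of_integrable (integrable_inner_prod hσ hμ)] at h1
  exact absurd (le_bot_iff.1 h1) (EReal.coe_ne_bot _)

end Couplings

namespace GibbsDensity

variable {d : ℕ} (P : GibbsDensity d)

lemma K_le (hN : μH[(d : ℝ) - 1] {x ∈ frontier P.O | ¬ContinuousAt P.p x} = 0) {R : ℝ}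
    (hR : 1 ≤ R) {F : Ed d → ℝ} (hF : Measurable F) (hF0 : ∀ x, 0 ≤ F x)
    (hF1 : ∫⁻ x, ENNReal.ofReal (F x) = 1) (hFR : ∀ x, F x ≠ 0 → x ∈ cube d R)
    (hFlog : Integrable fun x => F x * Real.log (F x)) :
    ∃ S : Ed d → Ed d, Measurable S ∧ Integrable (fun z => ⟪S z, P.g z⟫) P.ρ ∧
      P.ρ.map S = volume.withDensity (fun x => ENNReal.ofReal (F x)) ∧
      P.K ≤ (∫ x, F x * Real.log (F x)) + ∫ z, ⟪S z, P.g z⟫ ∂P.ρ +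
        P.α / 2 * ∫ x, F x * ‖x‖ ^ 2 := by
  obtain ⟨S, hS, hSR, hmap, hle⟩ := P.exists_transport hN hR hF hF0 hF1 hFR hFlog
  have hSn : ∀ z, ‖S z‖ ≤ √(d * R ^ 2) := fun z => norm_le_of_forall_mem_Icc (hSR z)
  have hSg := P.integrable_inner_of_bounded hS hSn
  have hS2 : Integrable (fun z => ‖S z‖ ^ 2) P.ρ := by
    refine Integrable.of_bound (by fun_prop) (√(d * R ^ 2) ^ 2)
      (Filter.Eventually.of_forall fun z => ?_)
    rw [Real.norm_of_nonneg (by positivity)]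
    exact pow_le_pow_left₀ (norm_nonneg _) (hSn z) 2
  have hint : ∫ z, ‖S z‖ ^ 2 ∂P.ρ = ∫ x, F x * ‖x‖ ^ 2 := by
    rw [← integral_withDensity_ofReal hF hF0, ← hmap]
    exact (integral_map (f := fun x : Ed d => ‖x‖ ^ 2) hS.aemeasurable (by fun_prop)).symm
  refine ⟨S, hS, hSg, hmap, ?_⟩
  have hSz : Integrable (fun z => ⟪S z, z⟫) P.ρ :=
    (P.integrable_norm.const_mul √(d * R ^ 2)).mono' (by fun_prop)
      (Filter.Eventually.of_forall fun z => (norm_inner_le_norm _ _).trans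
        (mul_le_mul_of_nonneg_right (hSn z) (norm_nonneg _)))
  have h1 : ∫ z, ⟪S z, P.g z + P.α • z⟫ ∂P.ρ =
      ∫ z, ⟪S z, P.g z⟫ ∂P.ρ + P.α * ∫ z, ⟪S z, z⟫ ∂P.ρ := by
    rw [← integral_const_mul, ← integral_add hSg (hSz.const_mul _)]
    simp only [inner_add_right, real_inner_smul_right]
  have h2 : ∫ z, ⟪S z, z⟫ ∂P.ρ ≤ ∫ z, (2⁻¹ * ‖S z‖ ^ 2 + 2⁻¹ * ‖z‖ ^ 2) ∂P.ρ := by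
    refine integral_mono hSz ((hS2.const_mul _).add (P.integrable_sq.const_mul _)) fun z => ?_
    have h3 := norm_sub_sq_real (S z) z
    have h4 := sq_nonneg ‖S z - z‖
    simp only
    linarith
  rw [integral_add (hS2.const_mul _) (P.integrable_sq.const_mul _), integral_const_mul,
    integral_const_mul, hint] at h2
  have h3 := mul_le_mul_of_nonneg_left h2 P.α_pos.le
  rw [K]
  linarith

lemma le_maxCorr_of_subset_cube
    (hN : μH[(d : ℝ) - 1] {x ∈ frontier P.O | ¬ContinuousAt P.p x} = 0)
    {F : Ed d → ℝ} (hF : Measurable F) (hF0 : ∀ x, 0 ≤ F x)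
    (hFlog : Integrable fun x => F x * Real.log (F x)) {σ : Measure (Ed d)}
    [IsProbabilityMeasure σ] (hσ : σ = volume.withDensity fun x => ENNReal.ofReal (F x))
    (hσ1 : Integrable (fun x => ‖x‖) σ)
    {R : ℝ} (hR : 1 ≤ R) {A : Set (Ed d)} (hA : MeasurableSet A) (hAR : A ⊆ cube d R)
    (hm : 0 < σ.real A) :
    ((σ.real A * P.K - (∫ x in A, F x * Real.log (F x)) + σ.real A * Real.log (σ.real A) -
      P.α / 2 * (∫ x in A, F x * ‖x‖ ^ 2) +
      ∫ q in Aᶜ ×ˢ Set.univ, ⟪q.1, q.2⟫ ∂(σ.prod P.μ) : ℝ) : EReal) ≤ maxCorr σ P.μ := by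
  set m := σ.real A with hmdef
  have hmE : ENNReal.ofReal m = σ A := ofReal_measureReal
  set q : Ed d → ℝ := A.indicator fun x => m⁻¹ * F x with hq
  have hqm : Measurable q := (hF.const_mul _).indicator hA
  have hq0 : ∀ x, 0 ≤ q x := fun x =>
    Set.indicator_nonneg (fun x _ => mul_nonneg (inv_nonneg.2 hm.le) (hF0 x)) x
  have hσA : σ.restrict A = σ A • volume.withDensity fun x => ENNReal.ofReal (q x) := by
    rw [← withDensity_smul _ hqm.ennreal_ofReal, hσ, restrict_withDensity hA,
      ← withDensity_indicator hA, ← hσ]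
    congr 1
    ext x
    by_cases hx : x ∈ A
    · simp only [hx, Set.indicator_of_mem, hq, Pi.smul_apply, smul_eq_mul]
      rw [← hmE, ← ENNReal.ofReal_mul hm.le, mul_inv_cancel_left₀ hm.ne']
    · simp [hx, hq]
  have hA0 : σ A ≠ 0 := fun h => by simp [hmdef, measureReal_def, h] at hm
  have hq1 : ∫⁻ x, ENNReal.ofReal (q x) = 1 := by
    have h := congrArg (fun ν : Measure (Ed d) => ν Set.univ) hσA
    simp only [Measure.restrict_apply_univ, Measure.smul_apply, smul_eq_mul,
      withDensity_apply _ MeasurableSet.univ, Measure.restrict_univ] at h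
    exact (ENNReal.mul_right_inj hA0 (measure_ne_top σ A)).1 (by rw [← h, mul_one])
  have hqlog : (fun x => q x * Real.log (q x)) =
      A.indicator fun x => m⁻¹ * (F x * Real.log (F x)) - m⁻¹ * Real.log m * F x := by
    ext x
    by_cases hx : x ∈ A
    · simp only [hq, hx, Set.indicator_of_mem]
      rcases (hF0 x).eq_or_lt with h0 | h0
      · simp [← h0]
      · rw [Real.log_mul (inv_ne_zero hm.ne') h0.ne', Real.log_inv]
        ring
    · simp [hq, hx]
  have hFi : Integrable F := by
    have h := integrable_const (μ := σ) (1 : ℝ)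
    rw [hσ, integrable_withDensity_ofReal_iff hF hF0] at h
    simpa using h
  have hFA : ∫ x in A, F x = m := by
    rw [hmdef, measureReal_def, hσ, withDensity_apply _ hA, integral_eq_lintegral_of_nonneg_ae
      (Filter.Eventually.of_forall hF0) hF.aestronglyMeasurable]
  have hi1 : Integrable fun x => m⁻¹ * (F x * Real.log (F x)) - m⁻¹ * Real.log m * F x :=
    (hFlog.const_mul _).sub (hFi.const_mul _)
  obtain ⟨S, hS, hSg, hmap, hle⟩ := P.K_le hN hR hqm hq0 hq1
    (fun x hx => hAR (by_contra fun h => hx (Set.indicator_of_notMem h _)))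
    (by rw [hqlog]; exact hi1.indicator hA)
  have hq2 : (fun x => q x * ‖x‖ ^ 2) = A.indicator fun x => m⁻¹ * (F x * ‖x‖ ^ 2) := by
    ext x
    by_cases hx : x ∈ A <;> simp [hq, hx, mul_assoc]
  rw [hqlog, hq2, integral_indicator hA, integral_indicator hA, integral_const_mul,
    integral_sub (hFlog.const_mul _).integrableOn (hFi.const_mul _).integrableOn,
    integral_const_mul, integral_const_mul, hFA] at hle
  have hSg' : Measurable fun z => (S z, P.g z) := hS.prodMk P.measurable_g
  set γ : Measure (Ed d × Ed d) := σ A • P.ρ.map (fun z => (S z, P.g z)) +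
    (σ.prod P.μ).restrict (Aᶜ ×ˢ Set.univ) with hγ
  have hr : (σ.prod P.μ).restrict (Aᶜ ×ˢ Set.univ) = (σ.restrict Aᶜ).prod P.μ := by
    rw [← Measure.prod_restrict, Measure.restrict_univ]
  have hγ1 : γ.map Prod.fst = σ := by
    rw [hγ, hr, Measure.map_add _ _ measurable_fst, Measure.map_smul,
      Measure.map_map measurable_fst hSg', Measure.map_fst_prod, measure_univ, one_smul]
    change σ A • P.ρ.map S + _ = _
    rw [hmap, ← hσA, Measure.restrict_add_restrict_compl hA]
  have hγ2 : γ.map Prod.snd = P.μ := by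
    rw [hγ, hr, Measure.map_add _ _ measurable_snd, Measure.map_smul,
      Measure.map_map measurable_snd hSg', Measure.map_snd_prod, Measure.restrict_apply_univ]
    change σ A • P.μ + _ = _
    rw [← add_smul, prob_add_prob_compl hA, one_smul]
  have hγp : IsProbabilityMeasure γ := by
    refine ⟨?_⟩
    rw [← Set.preimage_univ (f := Prod.fst), ← Measure.map_apply measurable_fst MeasurableSet.univ,
      hγ1, measure_univ]
  have hint1 : Integrable (fun q : Ed d × Ed d => ⟪q.1, q.2⟫) (P.ρ.map fun z => (S z, P.g z)) :=
    (integrable_map_measure (by fun_prop) hSg'.aemeasurable).2 hSg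
  have hint2 := (integrable_inner_prod hσ1 P.integrable_norm_μ).integrableOn (s := Aᶜ ×ˢ Set.univ)
  have hint3 := hint1.smul_measure (measure_ne_top σ A)
  refine le_trans ?_ (le_iSup₂_of_le γ ⟨hγp, hγ1, hγ2⟩ le_rfl)
  rw [sInt_of_integrable (hint3.add_measure hint2), integral_add_measure hint3 hint2,
    integral_smul_measure, integral_map hSg'.aemeasurable (by fun_prop), EReal.coe_le_coe_iff,
    ← measureReal_def, ← hmdef, smul_eq_mul]
  have h := mul_le_mul_of_nonneg_left hle hm.le
  have h2 : m * (m⁻¹ * (∫ x in A, F x * Real.log (F x)) - m⁻¹ * Real.log m * m +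
      ∫ z, ⟪S z, P.g z⟫ ∂P.ρ + P.α / 2 * (m⁻¹ * ∫ x in A, F x * ‖x‖ ^ 2)) =
      (∫ x in A, F x * Real.log (F x)) - m * Real.log m + m * ∫ z, ⟪S z, P.g z⟫ ∂P.ρ +
        P.α / 2 * ∫ x in A, F x * ‖x‖ ^ 2 := by
    field_simp
  linarith

lemma le_maxCorr
    (hN : μH[(d : ℝ) - 1] {x ∈ frontier P.O | ¬ContinuousAt P.p x} = 0)
    {F : Ed d → ℝ} (hF : Measurable F) (hF0 : ∀ x, 0 ≤ F x)
    (hFlog : Integrable fun x => F x * Real.log (F x))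
    (hF2 : Integrable fun x => F x * ‖x‖ ^ 2) {σ : Measure (Ed d)}
    [IsProbabilityMeasure σ] (hσ : σ = volume.withDensity fun x => ENNReal.ofReal (F x))
    (hσ1 : Integrable (fun x => ‖x‖) σ) :
    ((P.K - (∫ x, F x * Real.log (F x)) - P.α / 2 * ∫ x, F x * ‖x‖ ^ 2 : ℝ) : EReal) ≤
      maxCorr σ P.μ := by
  have hAm : ∀ n : ℕ, MeasurableSet (cube d n) := fun n => measurableSet_cube d n
  have hE := tendsto_setIntegral_of_monotone hAm (cube_mono d) hFlog.integrableOn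
  have hM := tendsto_setIntegral_of_monotone hAm (cube_mono d) hF2.integrableOn
  have hm : Filter.Tendsto (fun n : ℕ => σ.real (cube d n)) Filter.atTop (nhds 1) := by
    have h := tendsto_measure_iUnion_atTop (μ := σ) (cube_mono d)
    rw [iUnion_cube, measure_univ] at h
    exact (ENNReal.tendsto_toReal ENNReal.one_ne_top).comp h
  have hr := tendsto_setIntegral_of_antitone (μ := σ.prod P.μ)
    (f := fun q : Ed d × Ed d => ⟪q.1, q.2⟫) (s := fun n : ℕ => (cube d n)ᶜ ×ˢ Set.univ)
    (fun n => (hAm n).compl.prod MeasurableSet.univ)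
    (fun m n h => Set.prod_mono (Set.compl_subset_compl.2 (cube_mono d h)) le_rfl)
    ⟨0, (integrable_inner_prod hσ1 P.integrable_norm_μ).integrableOn⟩
  have hempty : ⋂ n : ℕ, (cube d n)ᶜ ×ˢ (Set.univ : Set (Ed d)) = ∅ := by
    refine Set.eq_empty_of_forall_notMem fun q hq => ?_
    obtain ⟨n, hn⟩ := Set.mem_iUnion.1 ((iUnion_cube d).ge (Set.mem_univ q.1))
    exact (Set.mem_iInter.1 hq n).1 hn
  rw [iUnion_cube, setIntegral_univ] at hE hM
  rw [hempty, setIntegral_empty] at hr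
  have hml := (Real.continuous_mul_log.tendsto 1).comp hm
  have hlim := ((((hm.mul_const P.K).sub hE).add hml).sub (hM.const_mul (P.α / 2))).add hr
  simp only [one_mul, Real.log_one, mul_zero, add_zero] at hlim
  refine le_of_tendsto ((continuous_coe_real_ereal.tendsto _).comp hlim) ?_
  filter_upwards [hm.eventually (lt_mem_nhds one_pos), Filter.eventually_ge_atTop 1] with n hn hn1
  have h1 : (1 : ℝ) ≤ n := by exact_mod_cast hn1
  exact P.le_maxCorr_of_subset_cube hN hF hF0 hFlog hσ hσ1 h1 (hAm n) le_rfl hn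

lemma le_Ffun (hN : μH[(d : ℝ) - 1] {x ∈ frontier P.O | ¬ContinuousAt P.p x} = 0)
    {σ : Measure (Ed d)} (hσ : σ ∈ P1 d) : (P.K : EReal) ≤ Ffun P.α P.μ σ := by
  have hσp : IsProbabilityMeasure σ := hσ.1
  have hT := maxCorr_ne_bot hσ.2 P.integrable_norm_μ
  have hα : 0 < P.α / 2 := half_pos P.α_pos
  have hM2 : 0 ≤ ((P.α / 2 : ℝ) : EReal) * ((M2e σ : ℝ≥0∞) : EReal) :=
    mul_nonneg (by exact_mod_cast hα.le) (EReal.coe_ennreal_nonneg _)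
  have hM2' := (EReal.bot_lt_zero.trans_le hM2).ne'
  rw [Ffun]
  by_cases hac : σ ≪ volume
  swap
  · rw [Ent, dif_neg hac, EReal.top_add_of_ne_bot hT, EReal.top_add_of_ne_bot hM2']
    exact le_top
  set F : Ed d → ℝ := fun x => (σ.rnDeriv volume x).toReal with hFdef
  have hF : Measurable F := (Measure.measurable_rnDeriv _ _).ennreal_toReal
  have hF0 : ∀ x, 0 ≤ F x := fun x => ENNReal.toReal_nonneg
  have hσF : σ = volume.withDensity fun x => ENNReal.ofReal (F x) := by
    refine (Measure.withDensity_rnDeriv_eq σ volume hac).symm.trans (withDensity_congr_ae ?_)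
    filter_upwards [Measure.rnDeriv_lt_top σ volume] with x hx
    exact (ENNReal.ofReal_toReal hx.ne).symm
  have hF1 : Integrable fun x => F x * ‖x‖ := by
    rw [← integrable_withDensity_ofReal_iff hF hF0, ← hσF]
    exact hσ.2
  have hneg := lintegral_neg_mul_log_ne_top hF0 hF1
  have hEnt : Ent σ = sInt volume fun x => F x * Real.log (F x) := by rw [Ent, dif_pos hac]
  have hEb : Ent σ ≠ ⊥ := hEnt ▸ sInt_ne_bot hneg
  have hETb : Ent σ + maxCorr σ P.μ ≠ ⊥ := by simp [EReal.add_eq_bot_iff, hEb, hT]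
  by_cases hEt : Ent σ = ⊤
  · rw [hEt, EReal.top_add_of_ne_bot hT, EReal.top_add_of_ne_bot hM2']
    exact le_top
  by_cases hMt : M2e σ = ⊤
  · rw [hMt, EReal.coe_ennreal_top, EReal.coe_mul_top_of_pos hα, EReal.add_top_of_ne_bot hETb]
    exact le_top
  have hFlog : Integrable fun x => F x * Real.log (F x) :=
    integrable_of_sInt_ne_top (hF.mul (Real.measurable_log.comp hF)).aestronglyMeasurable hneg
      (hEnt ▸ hEt)
  have hsq : Integrable (fun x => ‖x‖ ^ 2) σ := by
    refine ⟨by fun_prop, ?_⟩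
    rw [hasFiniteIntegral_iff_ofReal (Filter.Eventually.of_forall fun x => by positivity)]
    exact Ne.lt_top hMt
  have hF2 : Integrable fun x => F x * ‖x‖ ^ 2 := by
    rwa [← integrable_withDensity_ofReal_iff hF hF0, ← hσF]
  have hM : ((M2e σ : ℝ≥0∞) : EReal) = ((∫ x, F x * ‖x‖ ^ 2 : ℝ) : EReal) := by
    rw [M2e, ← ofReal_integral_eq_lintegral_ofReal hsq
      (Filter.Eventually.of_forall fun x => by positivity),
      EReal.coe_ennreal_ofReal, max_eq_left (integral_nonneg fun _ => by positivity),
      ← integral_withDensity_ofReal hF hF0, ← hσF]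
  have hle := P.le_maxCorr hN hF hF0 hFlog hF2 hσF hσ.2
  rw [hM, hEnt, sInt_of_integrable hFlog]
  refine le_trans (le_of_eq ?_) (add_le_add_left (add_le_add_right hle _) _)
  norm_cast
  ring

end GibbsDensity

section ConvexEReal

variable {d : ℕ} {u : Ed d → EReal}

lemma EConvexOn.eq_bot (hu : EConvexOn u) {x₀ : Ed d} (h0 : u x₀ = ⊥) (z : Ed d) : u z = ⊥ := by
  have h := hu x₀ ((2 : ℝ) • z - x₀) 2⁻¹ 2⁻¹ (by norm_num) (by norm_num) (by norm_num)
  have h1 : (2⁻¹ : ℝ) • x₀ + (2⁻¹ : ℝ) • ((2 : ℝ) • z - x₀) = z := by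
    rw [smul_sub, smul_smul]
    norm_num
  rw [h1, h0, EReal.coe_mul_bot_of_pos (by norm_num), EReal.bot_add] at h
  exact le_bot_iff.1 h

lemma coe_mul_ne_top {s : ℝ} (hs : 0 ≤ s) {a : EReal} (ha : a ≠ ⊤) : (s : EReal) * a ≠ ⊤ := by
  induction a with
  | bot =>
    rcases hs.eq_or_lt with rfl | hs
    · simp
    · simp [EReal.coe_mul_bot_of_pos hs]
  | coe a => exact_mod_cast EReal.coe_ne_top (s * a)
  | top => exact absurd rfl ha

lemma EConvexOn.convex_lt_top (hu : EConvexOn u) : Convex ℝ {y | u y < ⊤} :=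
  fun x hx y hy s t hs ht hst => (hu x y s t hs ht hst).trans_lt <|
    EReal.add_lt_top (coe_mul_ne_top hs hx.ne) (coe_mul_ne_top ht hy.ne)

lemma EConvexOn.convexOn_toReal (hu : EConvexOn u) :
    ConvexOn ℝ {y | u y < ⊤} fun y => (u y).toReal := by
  refine ⟨hu.convex_lt_top, fun x hx y hy s t hs ht hst => ?_⟩
  by_cases hbot : ∃ x₀, u x₀ = ⊥
  · obtain ⟨x₀, h0⟩ := hbot
    simp [hu.eq_bot h0]
  · push Not at hbot
    have hz := hu.convex_lt_top hx hy hs ht hst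
    have h := hu x y s t hs ht hst
    rw [← EReal.coe_toReal hx.ne (hbot x), ← EReal.coe_toReal hy.ne (hbot y),
      ← EReal.coe_toReal hz.ne (hbot _)] at h
    exact_mod_cast h

end ConvexEReal

/-- The density `exp (-u - α / 2 ‖·‖ ^ 2)` vanishes continuously wherever `u` is continuous on the
boundary of its domain. -/
lemma continuousAt_density_of_continuousAt {d : ℕ} {u : Ed d → EReal} {α : ℝ} (hα : 0 < α)
    {x : Ed d} (hx : x ∈ frontier (interior {y | u y < ⊤})) (hu : ContinuousAt u x) :
    ContinuousAt ((interior {y | u y < ⊤}).indicator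
      fun y => Real.exp (-(u y).toReal - α / 2 * ‖y‖ ^ 2)) x := by
  set O := interior {y | u y < ⊤}
  have hxO : x ∉ O := fun h => by
    rw [isOpen_interior.frontier_eq] at hx
    exact hx.2 h
  have hxtop : u x = ⊤ := by
    by_contra h
    exact hxO (mem_interior_iff_mem_nhds.2 (hu.eventually_lt_const (Ne.lt_top h)))
  rw [ContinuousAt, Set.indicator_of_notMem hxO]
  refine tendsto_order.2 ⟨fun c hc => Filter.Eventually.of_forall fun y => hc.trans_le ?_,
    fun c hc => ?_⟩
  · exact Set.indicator_nonneg (fun _ _ => (Real.exp_pos _).le) y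
  · have h : ∀ᶠ y in nhds x, ((-Real.log c : ℝ) : EReal) < u y :=
      hu.eventually_const_lt (by rw [hxtop]; exact EReal.coe_lt_top _)
    filter_upwards [h] with y hy
    by_cases hyO : y ∈ O
    · rw [Set.indicator_of_mem hyO]
      have hyt : y ∈ {y | u y < ⊤} := interior_subset hyO
      rw [← EReal.coe_toReal (ne_of_lt hyt) ((bot_le.trans_lt hy).ne'), EReal.coe_lt_coe_iff] at hy
      rw [← Real.exp_log hc, Real.exp_lt_exp]
      have : 0 ≤ α / 2 * ‖y‖ ^ 2 := by positivity
      linarith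
    · rwa [Set.indicator_of_notMem hyO]

lemma withDensity_gdens {d : ℕ} {u : Ed d → EReal} (hu : EConvexOn u) (α : ℝ) :
    (volume : Measure (Ed d)).withDensity (gdens α u) =
      (volume.restrict (interior {y | u y < ⊤})).withDensity
        fun x => ENNReal.ofReal (Real.exp (-(u x).toReal - α / 2 * ‖x‖ ^ 2)) := by
  rw [← withDensity_indicator isOpen_interior.measurableSet]
  refine withDensity_congr_ae ?_
  filter_upwards [measure_eq_zero_iff_ae_notMem.1
    (hu.convex_lt_top.addHaar_frontier (volume : Measure (Ed d)))] with x hx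
  by_cases h : x ∈ interior {y | u y < ⊤}
  · have hxt : x ∈ {y | u y < ⊤} := interior_subset h
    rw [Set.indicator_of_mem h, gdens, if_neg (ne_of_lt hxt)]
  · rw [Set.indicator_of_notMem h, gdens, if_pos]
    by_contra htop
    exact hx ⟨subset_closure (Ne.lt_top htop), h⟩

/-- every Gaussian-regularized log-concave probability density arising from a
convex essentially continuous potential is the minimizer of `F_μ` for `μ` the pushforward
of the density under the gradient of the potential. -/
theorem stmt8 (d : ℕ) (hd : 1 ≤ d) (α : ℝ) (hα : 0 < α)
    (u : Ed d → EReal) (hconv : EConvexOn u) (hec : EssentiallyContinuous u)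
    (ρb : Measure (Ed d)) (hρb : ρb = (volume : Measure (Ed d)).withDensity (gdens α u))
    (hprob : IsProbabilityMeasure ρb)
    (g : Ed d → Ed d) (hgm : AEMeasurable g ρb)
    (hg : ∀ᵐ x ∂ρb, HasGradientAt (fun y => (u y).toReal) (g x) x)
    (μ : Measure (Ed d)) (hμ : μ = ρb.map g) :
    ρb ∈ P1 d ∧ IsMinOfF α μ ρb := by
  set O := interior {y | u y < ⊤} with hO
  set w : Ed d → ℝ≥0∞ := fun x => ENNReal.ofReal (Real.exp (-(u x).toReal - α / 2 * ‖x‖ ^ 2))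
  have hconvO : ConvexOn ℝ O fun y => (u y).toReal :=
    hconv.convexOn_toReal.subset interior_subset hconv.convex_lt_top.interior
  have hw : AEMeasurable w (volume.restrict O) := by
    have h := hconvO.continuousOn isOpen_interior
    have h' : ContinuousOn (fun x => Real.exp (-(u x).toReal - α / 2 * ‖x‖ ^ 2)) O := by fun_prop
    exact (h'.aemeasurable isOpen_interior.measurableSet).ennreal_ofReal
  rw [withDensity_gdens hconv] at hρb
  obtain ⟨g', hgm', hgg'⟩ := hgm
  have hgrad : ∀ᵐ x ∂ρb, HasGradientAt (fun y => (u y).toReal) (g' x) x := by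
    filter_upwards [hg, hgg'] with x hx hgx
    rwa [← hgx]
  let P : GibbsDensity d :=
    { α := α
      α_pos := hα
      O := O
      isOpen := isOpen_interior
      f := fun y => (u y).toReal
      convexOn := hconvO
      g := g'
      measurable_g := hgm'
      grad := by
        rw [hρb, ae_withDensity_iff' hw,
          ae_restrict_iff' isOpen_interior.measurableSet] at hgrad
        filter_upwards [hgrad] with x hx hxO
        exact hx hxO (ENNReal.ofReal_pos.2 (Real.exp_pos _)).ne'
      mass := by
        have h := hprob.measure_univ
        rwa [hρb, withDensity_apply _ MeasurableSet.univ, Measure.restrict_univ] at h }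
  have hρ : P.ρ = ρb := by
    rw [hρb, ← withDensity_indicator isOpen_interior.measurableSet, GibbsDensity.ρ]
    congr 1
    ext x
    by_cases hx : x ∈ O
    · rw [P.p_of_mem hx, Set.indicator_of_mem hx]
    · rw [P.p_of_notMem hx, Set.indicator_of_notMem hx, ENNReal.ofReal_zero]
  have hμP : P.μ = μ := by
    rw [hμ, GibbsDensity.μ, hρ]
    exact Measure.map_congr hgg'.symm
  have hN : μH[(d : ℝ) - 1] {x ∈ frontier P.O | ¬ContinuousAt P.p x} = 0 := by
    refine measure_mono_null ?_ hec
    rintro x ⟨hxO, hxp⟩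
    exact ⟨frontier_interior_subset hxO,
      fun hux => hxp (continuousAt_density_of_continuousAt hα hxO hux)⟩
  have hmem : ρb ∈ P1 d := ⟨hprob, hρ ▸ P.integrable_norm⟩
  refine ⟨hmem, hmem, fun σ hσ => ?_⟩
  rw [← hρ, ← hμP]
  exact (P.Ffun_ρ_le (P.integral_inner_grad_eq_zero hN)).trans (P.le_Ffun hN hσ)
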